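/- Let (f_n)_{n≥0} be a uniformly attracting sequence of automorphisms of ℂ² with constants 0<C<D<1 satisfying D^{11/5} < C. Then the basin of attraction Ω_{(f_n)} is biholomorphic to ℂ². -/

import Mathlib

open Set Filter Metric Topology Asymptotics

noncomputable section

/-- An automorphism of ℂ²: a biholomorphic map of ℂ² onto itself. -/
def IsAutomorphism (f : (ℂ × ℂ) → (ℂ × ℂ)) : Prop :=
  AnalyticOn ℂ f Set.univ ∧
    ∃ g : (ℂ × ℂ) → (ℂ × ℂ), AnalyticOn ℂ g Set.univ ∧
      Function.LeftInverse g f ∧ Function.RightInverse g f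

/-- `seqComp f n = f n ∘ ⋯ ∘ f 0`. -/
def seqComp (f : ℕ → (ℂ × ℂ) → (ℂ × ℂ)) : ℕ → (ℂ × ℂ) → (ℂ × ℂ)
  | 0 => f 0
  | n + 1 => f (n + 1) ∘ seqComp f n

/-- The basin of attraction of the sequence `(f n)`. -/
def basin (f : ℕ → (ℂ × ℂ) → (ℂ × ℂ)) : Set (ℂ × ℂ) :=
  {z | Tendsto (fun n => seqComp f n z) atTop (𝓝 0)}

/-- A sequence of maps fixing the origin is uniformly attracting with constants `C < D`
if `C‖z‖ ≤ ‖f n z‖ ≤ D‖z‖` on the open unit ball. -/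
def UniformlyAttracting (f : ℕ → (ℂ × ℂ) → (ℂ × ℂ)) (C D : ℝ) : Prop :=
  (∀ n, f n 0 = 0) ∧
    ∀ n, ∀ z : ℂ × ℂ, ‖z‖ < 1 → C * ‖z‖ ≤ ‖f n z‖ ∧ ‖f n z‖ ≤ D * ‖z‖

/-- `U` is biholomorphic to `V`. -/
def BiholomorphicTo (U V : Set (ℂ × ℂ)) : Prop :=
  ∃ Φ Ψ : (ℂ × ℂ) → (ℂ × ℂ), AnalyticOn ℂ Φ U ∧ AnalyticOn ℂ Ψ V ∧
    MapsTo Φ U V ∧ MapsTo Ψ V U ∧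
    (∀ z ∈ U, Ψ (Φ z) = z) ∧ (∀ w ∈ V, Φ (Ψ w) = w)

/-- `f` has order of contact `k`: `f(z) = ℓ(z) + O(‖z‖^k)` near `0` with `ℓ` linear. -/
def OrderOfContact (f : (ℂ × ℂ) → (ℂ × ℂ)) (k : ℕ) : Prop :=
  ∃ l : (ℂ × ℂ) →L[ℂ] (ℂ × ℂ),
    (fun z => f z - l z) =O[𝓝 (0 : ℂ × ℂ)] fun z => ‖z‖ ^ k

section Osgood

variable {F : Type*} [NormedAddCommGroup F] [NormedSpace ℂ F]

/-- Integration over the square `[0, 2π]²` against a continuous function, as a continuous linear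
functional on bounded continuous functions. -/
def squareIntegral (g : ℝ × ℝ → F) (hg : Continuous g) (M : ℝ) (hM : ∀ x, ‖g x‖ ≤ M) :
    BoundedContinuousFunction (ℝ × ℝ) ℂ →L[ℂ] F :=
  LinearMap.mkContinuous
    { toFun := fun φ => ∫ s in (0 : ℝ)..(2 * Real.pi), ∫ t in (0 : ℝ)..(2 * Real.pi),
        φ (s, t) • g (s, t)
      map_add' := by
        intro φ ψ
        have hc (φ : BoundedContinuousFunction (ℝ × ℝ) ℂ) :
            Continuous fun p : ℝ × ℝ => φ p • g p := φ.continuous.smul hg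
        have hi (φ : BoundedContinuousFunction (ℝ × ℝ) ℂ) :
            Continuous fun s : ℝ => ∫ t in (0 : ℝ)..(2 * Real.pi), φ (s, t) • g (s, t) :=
          intervalIntegral.continuous_parametric_intervalIntegral_of_continuous' (hc φ) _ _
        rw [← intervalIntegral.integral_add ((hi φ).intervalIntegrable _ _)
          ((hi ψ).intervalIntegrable _ _)]
        refine intervalIntegral.integral_congr fun s _ => ?_
        rw [← intervalIntegral.integral_add]
        · simp [add_smul]
        · exact ((hc φ).comp (by fun_prop : Continuous fun t : ℝ => (s, t))).intervalIntegrable _ _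
        · exact ((hc ψ).comp (by fun_prop : Continuous fun t : ℝ => (s, t))).intervalIntegrable _ _
      map_smul' := by
        intro c φ
        simp [mul_smul, intervalIntegral.integral_smul] }
    (M * (2 * Real.pi) * (2 * Real.pi)) (by
      intro φ
      have hπ : (0 : ℝ) ≤ 2 * Real.pi := by positivity
      have h1 (s : ℝ) : ‖∫ t in (0 : ℝ)..(2 * Real.pi), φ (s, t) • g (s, t)‖ ≤
          ‖φ‖ * M * (2 * Real.pi) := by
        have := intervalIntegral.norm_integral_le_of_norm_le_const (a := 0) (b := 2 * Real.pi)
          (f := fun t => φ (s, t) • g (s, t)) (C := ‖φ‖ * M) (by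
            intro t _
            rw [norm_smul]
            exact mul_le_mul (φ.norm_coe_le_norm _) (hM _) (norm_nonneg _) (norm_nonneg _))
        simpa [abs_of_nonneg hπ, abs_of_nonneg Real.pi_nonneg] using this
      have h2 := intervalIntegral.norm_integral_le_of_norm_le_const (a := 0) (b := 2 * Real.pi)
          (f := fun s => ∫ t in (0 : ℝ)..(2 * Real.pi), φ (s, t) • g (s, t))
          (fun s _ => h1 s)
      simp only [sub_zero, abs_of_nonneg hπ] at h2
      simp only [LinearMap.coe_mk, AddHom.coe_mk]
      linarith)

theorem squareIntegral_apply (g : ℝ × ℝ → F) (hg : Continuous g) (M : ℝ) (hM : ∀ x, ‖g x‖ ≤ M)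
    (φ : BoundedContinuousFunction (ℝ × ℝ) ℂ) :
    squareIntegral g hg M hM φ = ∫ s in (0 : ℝ)..(2 * Real.pi), ∫ t in (0 : ℝ)..(2 * Real.pi),
        φ (s, t) • g (s, t) := rfl

/-- The function `(s, t) ↦ circleMap a R s`, or with `t` in place of `s`. -/
def circleBCF (a : ℂ) (R : ℝ) (π : ℝ × ℝ → ℝ) (hπ : Continuous π) :
    BoundedContinuousFunction (ℝ × ℝ) ℂ :=
  BoundedContinuousFunction.ofNormedAddCommGroup (fun p => circleMap a R (π p))
    ((continuous_circleMap a R).comp hπ) (‖a‖ + |R|) (by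
      intro p
      have : circleMap a R (π p) = a + circleMap 0 R (π p) := by simp [circleMap]
      rw [this]
      refine (norm_add_le _ _).trans ?_
      simp)

theorem isUnit_circleBCF_sub (a : ℂ) {R : ℝ} (hR : 0 < R) (π : ℝ × ℝ → ℝ) (hπ : Continuous π) :
    IsUnit (circleBCF a R π hπ - a • (1 : BoundedContinuousFunction (ℝ × ℝ) ℂ)) := by
  refine IsUnit.of_mul_eq_one (circleBCF 0 R⁻¹ (fun p => - π p) hπ.neg) ?_
  ext p
  have hR' : (R : ℂ) ≠ 0 := by exact_mod_cast hR.ne'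
  simp only [circleBCF, circleMap, BoundedContinuousFunction.coe_mul, Pi.mul_apply,
    BoundedContinuousFunction.coe_sub, Pi.sub_apply, BoundedContinuousFunction.coe_smul,
    BoundedContinuousFunction.coe_one, Pi.one_apply,
    BoundedContinuousFunction.coe_ofNormedAddCommGroup, smul_eq_mul, mul_one,
    Complex.ofReal_neg, Complex.ofReal_inv, neg_mul, Complex.exp_neg]
  have := Complex.exp_ne_zero (π p * Complex.I)
  field_simp
  simp

theorem BoundedContinuousFunction.inverse_apply_of_isUnit
    {u : BoundedContinuousFunction (ℝ × ℝ) ℂ} (hu : IsUnit u) (p : ℝ × ℝ) :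
    Ring.inverse u p = (u p)⁻¹ := by
  have h := congrArg (fun φ : BoundedContinuousFunction (ℝ × ℝ) ℂ => φ p)
    (Ring.inverse_mul_cancel u hu)
  simp only [BoundedContinuousFunction.coe_mul, Pi.mul_apply,
    BoundedContinuousFunction.coe_one, Pi.one_apply] at h
  exact eq_inv_of_mul_eq_one_left h

/-- **Osgood's lemma** in two variables. -/
theorem analyticAt_of_continuousOn_of_slices [CompleteSpace F] {f : ℂ × ℂ → F} {c : ℂ × ℂ} {R : ℝ}
    (hR : 0 < R) (hf : ContinuousOn f (closedBall c R))
    (h₁ : ∀ w ∈ closedBall c.2 R, DifferentiableOn ℂ (fun z => f (z, w)) (closedBall c.1 R))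
    (h₂ : ∀ z ∈ closedBall c.1 R, DifferentiableOn ℂ (fun w => f (z, w)) (closedBall c.2 R)) :
    AnalyticAt ℂ f c := by
  obtain ⟨M, hM⟩ := (isCompact_closedBall c R).exists_bound_of_continuousOn hf
  have hmem (s t : ℝ) : (circleMap c.1 R s, circleMap c.2 R t) ∈ closedBall c R := by
    rw [← Prod.mk.eta (p := c), ← closedBall_prod_same]
    exact ⟨circleMap_mem_closedBall _ hR.le _, circleMap_mem_closedBall _ hR.le _⟩
  set g : ℝ × ℝ → F := fun p => ((2 * Real.pi * Complex.I : ℂ)⁻¹ * (2 * Real.pi * Complex.I : ℂ)⁻¹ *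
    (deriv (circleMap c.1 R) p.1 * deriv (circleMap c.2 R) p.2)) •
      f (circleMap c.1 R p.1, circleMap c.2 R p.2) with hgdef
  have hg0 : Continuous fun p : ℝ × ℝ => f (circleMap c.1 R p.1, circleMap c.2 R p.2) := by
    refine hf.comp_continuous ?_ (fun p => hmem _ _)
    exact ((continuous_circleMap _ _).comp continuous_fst).prodMk
      ((continuous_circleMap _ _).comp continuous_snd)
  have hg : Continuous g := by
    refine Continuous.smul ?_ hg0
    simp only [deriv_circleMap]
    have := continuous_circleMap (0 : ℂ) R
    fun_prop
  have hgM : ∀ p, ‖g p‖ ≤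
      ‖(2 * Real.pi * Complex.I : ℂ)⁻¹ * (2 * Real.pi * Complex.I : ℂ)⁻¹‖ * (R * R) * M := by
    intro p
    rw [hgdef]
    simp only [norm_smul, norm_mul, deriv_circleMap, norm_circleMap_zero, Complex.norm_I, mul_one,
      abs_of_pos hR]
    exact mul_le_mul_of_nonneg_left (hM _ (hmem _ _)) (by positivity)
  set X := circleBCF c.1 R Prod.fst continuous_fst
  set Y := circleBCF c.2 R Prod.snd continuous_snd
  set P : ℂ × ℂ → BoundedContinuousFunction (ℝ × ℝ) ℂ :=
    fun x => (X - x.1 • 1) * (Y - x.2 • 1) with hP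
  have hPu : IsUnit (P c) :=
    (isUnit_circleBCF_sub c.1 hR Prod.fst continuous_fst).mul
      (isUnit_circleBCF_sub c.2 hR Prod.snd continuous_snd)
  have hPan : AnalyticAt ℂ P c := by
    have a1 : AnalyticAt ℂ (fun x : ℂ × ℂ => x.1) c := analyticAt_fst
    have a2 : AnalyticAt ℂ (fun x : ℂ × ℂ => x.2) c := analyticAt_snd
    exact (analyticAt_const.sub (a1.smul analyticAt_const)).mul
      (analyticAt_const.sub (a2.smul analyticAt_const))
  have hinv : AnalyticAt ℂ (fun x => Ring.inverse (P x)) c := by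
    have := analyticAt_inverse (𝕜 := ℂ) hPu.unit
    exact AnalyticAt.fun_comp (by simpa using this) hPan
  have htot : AnalyticAt ℂ (fun x => squareIntegral g hg _ hgM (Ring.inverse (P x))) c :=
    ((squareIntegral g hg _ hgM).analyticAt _).fun_comp hinv
  refine htot.congr ?_
  have hunit : ∀ᶠ x in 𝓝 c, IsUnit (P x) :=
    hPan.continuousAt.eventually (Units.isOpen.mem_nhds hPu)
  filter_upwards [hunit, ball_mem_nhds c hR] with x hx hxR
  have hx12 : x.1 ∈ ball c.1 R ∧ x.2 ∈ ball c.2 R := by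
    rw [← Prod.mk.eta (p := c), ← ball_prod_same] at hxR
    exact hxR
  rw [squareIntegral_apply]
  have e1 : f x = (2 * Real.pi * Complex.I : ℂ)⁻¹ • ∮ z in C(c.1, R), (z - x.1)⁻¹ • f (z, x.2) := by
    have hd : DiffContOnCl ℂ (fun z => f (z, x.2)) (ball c.1 R) := by
      refine DifferentiableOn.diffContOnCl ?_
      rw [closure_ball _ hR.ne']
      exact h₁ _ (ball_subset_closedBall hx12.2)
    rw [hd.two_pi_i_inv_smul_circleIntegral_sub_inv_smul hx12.1]
  have e2 : ∀ z ∈ closedBall c.1 R, f (z, x.2) =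
      (2 * Real.pi * Complex.I : ℂ)⁻¹ • ∮ w in C(c.2, R), (w - x.2)⁻¹ • f (z, w) := by
    intro z hz
    have hd : DiffContOnCl ℂ (fun w => f (z, w)) (ball c.2 R) := by
      refine DifferentiableOn.diffContOnCl ?_
      rw [closure_ball _ hR.ne']
      exact h₂ _ hz
    rw [hd.two_pi_i_inv_smul_circleIntegral_sub_inv_smul hx12.2]
  rw [e1, circleIntegral, ← intervalIntegral.integral_smul]
  refine intervalIntegral.integral_congr fun s _ => ?_
  rw [e2 _ (circleMap_mem_closedBall _ hR.le _), circleIntegral,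
    ← intervalIntegral.integral_smul, ← intervalIntegral.integral_smul,
    ← intervalIntegral.integral_smul, ← intervalIntegral.integral_smul]
  refine intervalIntegral.integral_congr fun t _ => ?_
  simp only [hgdef]
  rw [BoundedContinuousFunction.inverse_apply_of_isUnit hx, hP]
  simp only [smul_smul]
  congr 1
  simp only [BoundedContinuousFunction.coe_mul, Pi.mul_apply, BoundedContinuousFunction.coe_sub,
    Pi.sub_apply, BoundedContinuousFunction.coe_smul, BoundedContinuousFunction.coe_one,
    Pi.one_apply, smul_eq_mul, mul_one, mul_inv, X, Y, circleBCF,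
    BoundedContinuousFunction.coe_ofNormedAddCommGroup]
  ring

/-- A locally uniform limit of analytic functions of two variables is analytic. -/
theorem analyticOnNhd_of_tendstoUniformlyOn [CompleteSpace F] {f : ℕ → ℂ × ℂ → F}
    {φ : ℂ × ℂ → F} {U : Set (ℂ × ℂ)} (hU : IsOpen U) (hf : ∀ n, AnalyticOnNhd ℂ (f n) U)
    (h : TendstoUniformlyOn f φ atTop U) : AnalyticOnNhd ℂ φ U := by
  have hcont : ContinuousOn φ U :=
    h.continuousOn (Frequently.of_forall fun n => (hf n).continuousOn)
  have hs₁ (w : ℂ) : DifferentiableOn ℂ (fun z => φ (z, w)) ((fun z : ℂ => (z, w)) ⁻¹' U) := by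
    refine TendstoLocallyUniformlyOn.differentiableOn (F := fun n z => f n (z, w)) (φ := atTop)
      ?_ (Eventually.of_forall fun n => ?_) (hU.preimage (by fun_prop))
    · exact (h.comp (fun z : ℂ => (z, w))).tendstoLocallyUniformlyOn
    · exact (hf n).differentiableOn.comp (by fun_prop) (mapsTo_preimage _ _)
  have hs₂ (z : ℂ) : DifferentiableOn ℂ (fun w => φ (z, w)) ((fun w : ℂ => (z, w)) ⁻¹' U) := by
    refine TendstoLocallyUniformlyOn.differentiableOn (F := fun n w => f n (z, w)) (φ := atTop)
      ?_ (Eventually.of_forall fun n => ?_) (hU.preimage (by fun_prop))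
    · exact (h.comp (fun w : ℂ => (z, w))).tendstoLocallyUniformlyOn
    · exact (hf n).differentiableOn.comp (by fun_prop) (mapsTo_preimage _ _)
  intro c hc
  obtain ⟨R, hR, hRU⟩ := nhds_basis_closedBall.mem_iff.1 (hU.mem_nhds hc)
  have hRU' : closedBall c.1 R ×ˢ closedBall c.2 R ⊆ U := by
    rwa [closedBall_prod_same]
  exact analyticAt_of_continuousOn_of_slices hR (hcont.mono hRU)
    (fun w hw => (hs₁ w).mono fun z hz => hRU' ⟨hz, hw⟩)
    (fun z hz => (hs₂ z).mono fun w hw => hRU' ⟨hz, hw⟩)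

end Osgood

section NearIdentity

variable {E F : Type*} [NormedAddCommGroup E] [NormedSpace ℂ E]
  [NormedAddCommGroup F] [NormedSpace ℂ F]

/-- Cauchy's estimate for the derivative of a holomorphic map bounded on a ball. -/
theorem norm_fderiv_le_of_norm_le {ψ : E → F} {c : E} {r M : ℝ} (hr : 0 < r)
    (hd : DifferentiableOn ℂ ψ (ball c r)) (hM : ∀ x ∈ ball c r, ‖ψ x‖ ≤ M) :
    ‖fderiv ℂ ψ c‖ ≤ 2 * M / r := by
  refine Complex.norm_fderiv_le_div_of_mapsTo_ball hd (fun x hx => ?_) hr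
  rw [mem_closedBall, dist_eq_norm]
  have h1 := hM x hx
  have h2 := hM c (mem_ball_self hr)
  exact (norm_sub_le _ _).trans (by linarith)

/-- A holomorphic map that is uniformly close to the identity on a ball is injective on a smaller
ball, and has an analytic right inverse there. -/
theorem exists_analytic_inverse_of_near_id [CompleteSpace E] {Φ : E → E} {ρ : ℝ} (hρ : 0 < ρ)
    (hΦ : AnalyticOnNhd ℂ Φ (ball 0 ρ)) (hid : ∀ x ∈ ball (0 : E) ρ, ‖Φ x - x‖ ≤ ρ / 16) :
    InjOn Φ (ball 0 (ρ / 2)) ∧ ∃ Ψ : E → E, AnalyticOnNhd ℂ Ψ (ball 0 (ρ / 8)) ∧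
      ∀ y ∈ ball (0 : E) (ρ / 8), Ψ y ∈ ball (0 : E) (ρ / 2) ∧ Φ (Ψ y) = y := by
  rcases subsingleton_or_nontrivial E with hE | hE
  · refine ⟨fun x _ y _ _ => Subsingleton.elim _ _, id, fun _ _ => analyticAt_id, fun y hy => ?_⟩
    exact ⟨by rw [Subsingleton.elim (id y) 0]; exact mem_ball_self (by linarith),
      Subsingleton.elim _ _⟩
  have hsub : ∀ x ∈ ball (0 : E) (ρ / 2), ball x (ρ / 2) ⊆ ball 0 ρ := fun x hx =>
    ball_subset_ball' (by rw [mem_ball] at hx; linarith)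
  have hmem : ∀ x ∈ ball (0 : E) (ρ / 2), x ∈ ball (0 : E) ρ := fun x hx =>
    ball_subset_ball (by linarith) hx
  have hder : ∀ x ∈ ball (0 : E) (ρ / 2), ‖fderiv ℂ (fun x => Φ x - x) x‖ ≤ 1 / 4 := by
    intro x hx
    have := norm_fderiv_le_of_norm_le (ψ := fun x => Φ x - x) (c := x) (r := ρ / 2) (M := ρ / 16)
      (by linarith) (((hΦ.differentiableOn).sub differentiableOn_id).mono (hsub x hx))
      (fun y hy => hid y (hsub x hx hy))
    refine this.trans (le_of_eq ?_)
    field_simp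
    norm_num
  have hlip : LipschitzOnWith (1 / 4) (fun x => Φ x - x) (ball (0 : E) (ρ / 2)) := by
    refine (convex_ball (0 : E) (ρ / 2)).lipschitzOnWith_of_nnnorm_fderiv_le (𝕜 := ℂ)
      (fun x hx => ?_) (fun x hx => ?_)
    · exact (hΦ x (hmem x hx)).differentiableAt.sub differentiableAt_id
    · rw [← NNReal.coe_le_coe]
      simpa using hder x hx
  set I : E ≃L[ℂ] E := ContinuousLinearEquiv.refl ℂ E with hI
  have happ : ApproximatesLinearOn Φ (I : E →L[ℂ] E) (ball 0 (ρ / 2)) (1 / 4) := by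
    intro x hx y hy
    have := hlip.dist_le_mul x hx y hy
    rw [dist_eq_norm, dist_eq_norm] at this
    have hsub' : Φ x - Φ y - (I : E →L[ℂ] E) (x - y) = Φ x - x - (Φ y - y) := by
      change Φ x - Φ y - (x - y) = _
      abel
    rwa [hsub']
  have hN : ‖(I.symm : E →L[ℂ] E)‖₊ = 1 := by
    rw [← NNReal.coe_inj]
    simp [hI]
  have hc : Subsingleton E ∨ (1 / 4 : NNReal) < ‖(I.symm : E →L[ℂ] E)‖₊⁻¹ := by
    right
    rw [hN, inv_one, ← NNReal.coe_lt_coe]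
    norm_num
  refine ⟨happ.injOn hc, ?_⟩
  set e := happ.toOpenPartialHomeomorph Φ (ball 0 (ρ / 2)) hc isOpen_ball with he
  have hcl : closedBall (0 : E) (ρ / 4) ⊆ ball 0 (ρ / 2) :=
    closedBall_subset_ball (by linarith)
  have htar := happ.closedBall_subset_target hc isOpen_ball (b := 0) (ε := ρ / 4)
    (by linarith) hcl
  have htar' : ball (0 : E) (ρ / 8) ⊆ e.target := by
    refine Subset.trans (fun y hy => ?_) htar
    rw [mem_closedBall, dist_eq_norm, hN]
    have h0 := hid 0 (mem_ball_self hρ)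
    rw [mem_ball_zero_iff] at hy
    rw [sub_zero] at h0
    refine (norm_sub_le _ _).trans ?_
    simp only [NNReal.coe_one, inv_one, NNReal.coe_div, NNReal.coe_ofNat]
    linarith
  refine ⟨e.symm, fun y hy => ?_, fun y hy => ⟨?_, ?_⟩⟩
  · have hs : e.symm y ∈ ball (0 : E) (ρ / 2) := e.map_target (htar' hy)
    have han := hΦ _ (hmem _ hs)
    have hnear : ‖1 - fderiv ℂ Φ (e.symm y)‖ < 1 := by
      have h1 := hder _ hs
      have h2 : fderiv ℂ (fun x => Φ x - x) (e.symm y) = fderiv ℂ Φ (e.symm y) - 1 := by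
        rw [fderiv_fun_sub han.differentiableAt differentiableAt_fun_id, fderiv_fun_id]
        rfl
      rw [h2, norm_sub_rev] at h1
      linarith
    have hu : IsUnit (fderiv ℂ Φ (e.symm y)) := by
      have := isUnit_one_sub_of_norm_lt_one hnear
      simpa using this
    refine e.analyticAt_symm (i := ContinuousLinearEquiv.ofUnit hu.unit) (htar' hy) han ?_
    ext x
    rfl
  · exact e.map_target (htar' hy)
  · exact e.right_inv (htar' hy)

end NearIdentity

section Orbits

variable {E : Type*}

/-- `orbitMap f k n = f (k + n - 1) ∘ ⋯ ∘ f k`. -/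
def orbitMap (f : ℕ → E → E) : ℕ → ℕ → E → E
  | _, 0, x => x
  | k, n + 1, x => orbitMap f (k + 1) n (f k x)

/-- `pullback g k n = g k ∘ ⋯ ∘ g (k + n - 1)`. -/
def pullback (g : ℕ → E → E) : ℕ → ℕ → E → E
  | _, 0, y => y
  | k, n + 1, y => g k (pullback g (k + 1) n y)

theorem orbitMap_add (f : ℕ → E → E) (k m n : ℕ) (x : E) :
    orbitMap f k (m + n) x = orbitMap f (k + m) n (orbitMap f k m x) := by
  induction m generalizing k x with
  | zero => simp [orbitMap]
  | succ m ih =>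
    rw [Nat.add_right_comm, orbitMap, ih, orbitMap, Nat.add_right_comm, Nat.add_assoc k m 1]

theorem orbitMap_succ (f : ℕ → E → E) (k n : ℕ) (x : E) :
    orbitMap f k (n + 1) x = f (k + n) (orbitMap f k n x) := by
  rw [orbitMap_add]
  rfl

theorem pullback_add (g : ℕ → E → E) (k m n : ℕ) (y : E) :
    pullback g k (m + n) y = pullback g k m (pullback g (k + m) n y) := by
  induction m generalizing k with
  | zero => simp [pullback]
  | succ m ih =>
    rw [Nat.add_right_comm, pullback, ih, pullback, Nat.add_right_comm, Nat.add_assoc k m 1]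

theorem pullback_orbitMap {f g : ℕ → E → E} (h : ∀ n, Function.LeftInverse (g n) (f n))
    (k n : ℕ) (x : E) : pullback g k n (orbitMap f k n x) = x := by
  induction n generalizing k x with
  | zero => rfl
  | succ n ih => rw [pullback, orbitMap, ih, h]

theorem orbitMap_pullback {f g : ℕ → E → E} (h : ∀ n, Function.RightInverse (g n) (f n))
    (k n : ℕ) (x : E) : orbitMap f k n (pullback g k n x) = x := by
  induction n generalizing k x with
  | zero => rfl
  | succ n ih => rw [pullback, orbitMap, h, ih]

variable [NormedAddCommGroup E]

theorem analyticOnNhd_orbitMap [NormedSpace ℂ E] {f : ℕ → E → E}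
    (h : ∀ n, AnalyticOnNhd ℂ (f n) univ) (k n : ℕ) :
    AnalyticOnNhd ℂ (orbitMap f k n) univ := by
  induction n generalizing k with
  | zero => exact analyticOnNhd_id
  | succ n ih => exact (ih (k + 1)).comp (h k) (mapsTo_univ _ _)

theorem analyticOnNhd_pullback [NormedSpace ℂ E] {f : ℕ → E → E}
    (h : ∀ n, AnalyticOnNhd ℂ (f n) univ) (k n : ℕ) :
    AnalyticOnNhd ℂ (pullback f k n) univ := by
  induction n generalizing k with
  | zero => exact analyticOnNhd_id
  | succ n ih => exact (h k).comp (ih (k + 1)) (mapsTo_univ _ _)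

/-- The maps `h n` conjugate the contracting maps `f n` to `g n`, up to an error decaying like
`q ^ n`, while the inverses `gi n` of `g n` expand at most by the factor `c⁻¹ < q⁻¹`. -/
structure AsymptoticConjugacy (f h g gi : ℕ → E → E) (D c q : ℝ) : Prop where
  q_pos : 0 < q
  q_lt : q < c
  c_le : c ≤ D
  D_lt : D < 1
  contract : ∀ n x, ‖x‖ < 1 → ‖f n x‖ ≤ D * ‖x‖
  left_inv : ∀ n, Function.LeftInverse (gi n) (g n)
  right_inv : ∀ n, Function.RightInverse (gi n) (g n)
  near_id : ∀ M > 0, ∀ ε > 0, ∀ᶠ k in atTop, ∀ x, ‖x‖ ≤ M * D ^ k → ‖h k x - x‖ ≤ ε * D ^ k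
  error : ∀ M > 0, ∃ K, ∀ᶠ k in atTop, ∀ x, ‖x‖ ≤ M * D ^ k →
    ‖h (k + 1) (f k x) - g k (h k x)‖ ≤ K * q ^ k
  lip : ∀ M > 0, ∀ᶠ k in atTop, ∀ y y', ‖y‖ ≤ M * D ^ k → ‖y'‖ ≤ M * D ^ k →
    ‖gi k y - gi k y'‖ ≤ c⁻¹ * ‖y - y'‖

namespace AsymptoticConjugacy

variable {f h g gi : ℕ → E → E} {D c q : ℝ}

theorem c_pos (H : AsymptoticConjugacy f h g gi D c q) : 0 < c := H.q_pos.trans H.q_lt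

theorem D_pos (H : AsymptoticConjugacy f h g gi D c q) : 0 < D := H.c_pos.trans_le H.c_le

/-- Uniformly in `n`, the maps `x ↦ pullback gi k n (h (k + n) (orbitMap f k n x))` are well
defined close to the origin, close to the identity and have geometrically small increments. -/
theorem estimates (H : AsymptoticConjugacy f h g gi D c q) {M : ℝ} (hM : 0 < M) {ε : ℝ}
    (hε : 0 < ε) : ∃ K, 0 ≤ K ∧ ∀ᶠ k in atTop, ∀ n x, ‖x‖ ≤ M * D ^ k →
      ‖pullback gi k n (h (k + n) (orbitMap f k n x)) - x‖ ≤ ε * D ^ k ∧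
      ‖pullback gi k (n + 1) (h (k + (n + 1)) (orbitMap f k (n + 1) x)) -
        pullback gi k n (h (k + n) (orbitMap f k n x))‖ ≤ K * q ^ k * (q / c) ^ n := by
  have hq := H.q_pos
  have hc := H.c_pos
  have hD := H.D_pos
  obtain ⟨K₀, hK₀⟩ := H.error M hM
  set K := |K₀| / (c - q) with hKdef
  have hcq : 0 < c - q := sub_pos.2 H.q_lt
  have hK : 0 ≤ K := by positivity
  set η := min (ε / 2) (M / 2) with hη
  have hη0 : 0 < η := by positivity
  have hsmall : ∀ᶠ k : ℕ in atTop, K * q ^ k ≤ η * D ^ k := by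
    have h1 : Tendsto (fun k : ℕ => K * (q / D) ^ k) atTop (𝓝 (K * 0)) :=
      (tendsto_pow_atTop_nhds_zero_of_lt_one (by positivity)
        ((div_lt_one hD).2 (H.q_lt.trans_le H.c_le))).const_mul K
    rw [mul_zero] at h1
    filter_upwards [h1.eventually_lt_const hη0] with k hk
    rw [div_pow, ← mul_div_assoc, div_lt_iff₀ (by positivity)] at hk
    exact hk.le
  have hone : ∀ᶠ k : ℕ in atTop, M * D ^ k < 1 := by
    have h1 : Tendsto (fun k : ℕ => M * D ^ k) atTop (𝓝 (M * 0)) :=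
      (tendsto_pow_atTop_nhds_zero_of_lt_one hD.le H.D_lt).const_mul M
    rw [mul_zero] at h1
    exact h1.eventually_lt_const one_pos
  obtain ⟨k₀, hk₀⟩ := eventually_atTop.1 (hsmall.and (hone.and (hK₀.and
    ((H.near_id M hM η hη0).and (H.lip (2 * M) (by positivity))))))
  have hfx : ∀ k ≥ k₀, ∀ x, ‖x‖ ≤ M * D ^ k → ‖f k x‖ ≤ M * D ^ (k + 1) := by
    intro k hk x hx
    have := H.contract k x (hx.trans_lt (hk₀ k hk).2.1)
    calc ‖f k x‖ ≤ D * ‖x‖ := this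
      _ ≤ D * (M * D ^ k) := by gcongr
      _ = M * D ^ (k + 1) := by ring
  have hle : ∀ k, M * D ^ (k + 1) ≤ M * D ^ k := fun k =>
    mul_le_mul_of_nonneg_left (pow_le_pow_of_le_one hD.le H.D_lt.le (Nat.le_succ k)) hM.le
  have hhx : ∀ k ≥ k₀, ∀ x, ‖x‖ ≤ M * D ^ k → ‖h k x - x‖ ≤ η * D ^ k := fun k hk =>
    (hk₀ k hk).2.2.2.1
  have hηM : η ≤ M / 2 := min_le_right _ _
  have hηε : η ≤ ε / 2 := min_le_left _ _
  have claim : ∀ n, ∀ k ≥ k₀, ∀ x, ‖x‖ ≤ M * D ^ k →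
      ‖pullback gi k n (h (k + n) (orbitMap f k n x)) - h k x‖ ≤ K * q ^ k := by
    intro n
    induction n with
    | zero => intro k _ x _; simpa [pullback, orbitMap] using by positivity
    | succ n ih =>
      intro k hk x hx
      have hfx' := hfx k hk x hx
      have h1 := ih (k + 1) (hk.trans (Nat.le_succ k)) (f k x) hfx'
      have h2 := (hk₀ k hk).2.2.1 x hx
      have h3 := (hk₀ k hk).2.2.2.2
      rw [pullback, orbitMap, show k + (n + 1) = k + 1 + n by ring]
      set Y := pullback gi (k + 1) n (h (k + 1 + n) (orbitMap f (k + 1) n (f k x)))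
      have h4 := hhx (k + 1) (hk.trans (Nat.le_succ k)) (f k x) hfx'
      have hD1 : D ^ (k + 1) ≤ D ^ k := pow_le_pow_of_le_one hD.le H.D_lt.le (Nat.le_succ k)
      have hDk : 0 < D ^ (k + 1) := by positivity
      have h5 := (hk₀ (k + 1) (hk.trans (Nat.le_succ k))).1
      have hYn : ‖Y‖ ≤ 2 * M * D ^ k := by
        have e : Y = (Y - h (k + 1) (f k x)) + (h (k + 1) (f k x) - f k x) + f k x := by abel
        have : ‖Y‖ ≤ K * q ^ (k + 1) + η * D ^ (k + 1) + M * D ^ (k + 1) := by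
          rw [e]
          exact (norm_add₃_le).trans (by gcongr)
        calc ‖Y‖ ≤ _ := this
          _ ≤ 2 * M * D ^ (k + 1) := by nlinarith
          _ ≤ 2 * M * D ^ k := by gcongr
      have hYgh : ‖Y - g k (h k x)‖ ≤ K * q ^ (k + 1) + |K₀| * q ^ k := by
        have e : Y - g k (h k x) = (Y - h (k + 1) (f k x)) +
          (h (k + 1) (f k x) - g k (h k x)) := by abel
        rw [e]
        refine (norm_add_le _ _).trans (add_le_add h1 (h2.trans ?_))
        gcongr
        exact le_abs_self _
      have hKq : K * q ^ (k + 1) + |K₀| * q ^ k = c * (K * q ^ k) := by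
        rw [hKdef]
        field_simp
        ring
      have hgn : ‖g k (h k x)‖ ≤ 2 * M * D ^ k := by
        have e : g k (h k x) = (h (k + 1) (f k x) - f k x) + f k x -
          (h (k + 1) (f k x) - g k (h k x)) := by abel
        have hle2 : |K₀| ≤ K * c := by
          rw [hKdef, div_mul_eq_mul_div, le_div_iff₀ hcq]
          exact mul_le_mul_of_nonneg_left (by linarith) (abs_nonneg _)
        have h6 : ‖h (k + 1) (f k x) - g k (h k x)‖ ≤ η * D ^ k := by
          refine h2.trans ?_
          calc K₀ * q ^ k ≤ |K₀| * q ^ k := by gcongr; exact le_abs_self _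
            _ ≤ K * q ^ k := by
              gcongr
              exact hle2.trans (mul_le_of_le_one_right hK (H.c_le.trans H.D_lt.le))
            _ ≤ η * D ^ k := (hk₀ k hk).1
        have : ‖g k (h k x)‖ ≤ η * D ^ (k + 1) + M * D ^ (k + 1) + η * D ^ k := by
          rw [e]
          refine (norm_sub_le _ _).trans (add_le_add ((norm_add_le _ _).trans ?_) h6)
          gcongr
        calc ‖g k (h k x)‖ ≤ _ := this
          _ ≤ η * D ^ k + M * D ^ k + η * D ^ k := by gcongr
          _ ≤ 2 * M * D ^ k := by nlinarith [pow_pos hD k]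
      have h7 := h3 _ _ hYn hgn
      rw [H.left_inv k (h k x)] at h7
      calc _ ≤ c⁻¹ * ‖Y - g k (h k x)‖ := h7
        _ ≤ c⁻¹ * (c * (K * q ^ k)) := by
          rw [← hKq]
          gcongr
        _ = K * q ^ k := by field_simp
  have hclose : ∀ n, ∀ k ≥ k₀, ∀ x, ‖x‖ ≤ M * D ^ k →
      ‖pullback gi k n (h (k + n) (orbitMap f k n x)) - x‖ ≤ 2 * η * D ^ k := by
    intro n k hk x hx
    have e : pullback gi k n (h (k + n) (orbitMap f k n x)) - x =
      (pullback gi k n (h (k + n) (orbitMap f k n x)) - h k x) + (h k x - x) := by abel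
    rw [e]
    refine (norm_add_le _ _).trans ?_
    have := claim n k hk x hx
    have := hhx k hk x hx
    have := (hk₀ k hk).1
    linarith
  have hdiff : ∀ n, ∀ k ≥ k₀, ∀ x, ‖x‖ ≤ M * D ^ k →
      ‖pullback gi k (n + 1) (h (k + (n + 1)) (orbitMap f k (n + 1) x)) -
        pullback gi k n (h (k + n) (orbitMap f k n x))‖ ≤ K * q ^ k * (q / c) ^ n := by
    intro n
    induction n with
    | zero =>
      intro k hk x hx
      simpa [pullback, orbitMap] using claim 1 k hk x hx
    | succ n ih =>
      intro k hk x hx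
      have hfx' := hfx k hk x hx
      have hk' : k + 1 ≥ k₀ := hk.trans (Nat.le_succ k)
      have h1 := ih (k + 1) hk' (f k x) hfx'
      have hb : ∀ m, ‖pullback gi (k + 1) m (h (k + 1 + m) (orbitMap f (k + 1) m (f k x)))‖ ≤
          2 * M * D ^ k := by
        intro m
        have h2 := hclose m (k + 1) hk' (f k x) hfx'
        have h3 := norm_le_norm_add_norm_sub' (pullback gi (k + 1) m
          (h (k + 1 + m) (orbitMap f (k + 1) m (f k x)))) (f k x)
        have hD1 : D ^ (k + 1) ≤ D ^ k := pow_le_pow_of_le_one hD.le H.D_lt.le (Nat.le_succ k)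
        calc _ ≤ M * D ^ (k + 1) + 2 * η * D ^ (k + 1) := by linarith
          _ ≤ M * D ^ k + 2 * η * D ^ k := by gcongr
          _ ≤ 2 * M * D ^ k := by nlinarith [pow_pos hD k]
      have h7 := (hk₀ k hk).2.2.2.2 _ _ (hb (n + 1)) (hb n)
      rw [show k + (n + 1 + 1) = k + 1 + (n + 1) by ring]
      rw [show k + (n + 1) = k + 1 + n by ring]
      refine h7.trans ?_
      calc c⁻¹ * _ ≤ c⁻¹ * (K * q ^ (k + 1) * (q / c) ^ n) := by gcongr
        _ = K * q ^ k * (q / c) ^ (n + 1) := by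
          rw [pow_succ, pow_succ]
          field_simp
  refine ⟨K, hK, eventually_atTop.2 ⟨k₀, fun k hk n x hx => ⟨?_, hdiff n k hk x hx⟩⟩⟩
  refine (hclose n k hk x hx).trans ?_
  have := pow_pos hD k
  nlinarith

end AsymptoticConjugacy

end Orbits

theorem seqComp_eq_orbitMap (f : ℕ → (ℂ × ℂ) → (ℂ × ℂ)) (n : ℕ) :
    seqComp f n = orbitMap f 0 (n + 1) := by
  induction n with
  | zero => rfl
  | succ n ih =>
    funext x
    rw [orbitMap_succ, seqComp, ih, Nat.zero_add, Function.comp_apply]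

theorem mem_basin_iff {f : ℕ → (ℂ × ℂ) → (ℂ × ℂ)} {x : ℂ × ℂ} :
    x ∈ basin f ↔ Tendsto (fun n => orbitMap f 0 n x) atTop (𝓝 0) := by
  simp only [basin, mem_ofPred_eq, seqComp_eq_orbitMap]
  exact tendsto_add_atTop_iff_nat (f := fun n => orbitMap f 0 n x) 1

theorem norm_orbitMap_le {E : Type*} [NormedAddCommGroup E] {f : ℕ → E → E} {D : ℝ} (hD : 0 ≤ D)
    (hD1 : D ≤ 1) (hf : ∀ n x, ‖x‖ < 1 → ‖f n x‖ ≤ D * ‖x‖) (k n : ℕ) {x : E} (hx : ‖x‖ < 1) :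
    ‖orbitMap f k n x‖ ≤ D ^ n * ‖x‖ := by
  induction n with
  | zero => simp [orbitMap]
  | succ n ih =>
    rw [orbitMap_succ]
    have h1 : ‖orbitMap f k n x‖ < 1 :=
      (ih.trans (mul_le_of_le_one_left (norm_nonneg _) (pow_le_one₀ hD hD1))).trans_lt hx
    calc _ ≤ D * ‖orbitMap f k n x‖ := hf _ _ h1
      _ ≤ D * (D ^ n * ‖x‖) := by gcongr
      _ = _ := by ring

theorem mem_basin_of_norm_lt {f : ℕ → (ℂ × ℂ) → (ℂ × ℂ)} {D : ℝ} (hD : 0 ≤ D) (hD1 : D < 1)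
    (hf : ∀ n x, ‖x‖ < 1 → ‖f n x‖ ≤ D * ‖x‖) {x : ℂ × ℂ} {k : ℕ}
    (hx : ‖orbitMap f 0 k x‖ < 1) : x ∈ basin f := by
  rw [mem_basin_iff, ← tendsto_add_atTop_iff_nat k]
  have h1 : Tendsto (fun n => D ^ n * ‖orbitMap f 0 k x‖) atTop (𝓝 0) := by
    simpa using (tendsto_pow_atTop_nhds_zero_of_lt_one hD hD1).mul_const ‖orbitMap f 0 k x‖
  refine squeeze_zero_norm (fun n => ?_) h1
  rw [Nat.add_comm n k, orbitMap_add]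
  exact norm_orbitMap_le hD hD1.le hf _ _ hx

theorem exists_norm_orbitMap_le_of_mem_basin {f : ℕ → (ℂ × ℂ) → (ℂ × ℂ)} {D : ℝ} (hD : 0 < D)
    (hD1 : D ≤ 1) (hf : ∀ n x, ‖x‖ < 1 → ‖f n x‖ ≤ D * ‖x‖) {x : ℂ × ℂ} (hx : x ∈ basin f) :
    ∃ M, ∀ᶠ k in atTop, ‖orbitMap f 0 k x‖ ≤ M * D ^ k := by
  rw [mem_basin_iff] at hx
  obtain ⟨k, hk⟩ := ((tendsto_zero_iff_norm_tendsto_zero.1 hx).eventually_lt_const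
    one_pos).exists
  refine ⟨(D ^ k)⁻¹, eventually_atTop.2 ⟨k, fun n hn => ?_⟩⟩
  obtain ⟨m, rfl⟩ := Nat.exists_eq_add_of_le hn
  rw [orbitMap_add]
  calc _ ≤ D ^ m * ‖orbitMap f 0 k x‖ := norm_orbitMap_le hD.le hD1 hf _ _ hk
    _ ≤ D ^ m * 1 := by gcongr
    _ = (D ^ k)⁻¹ * D ^ (k + m) := by
      rw [pow_add]
      field_simp

namespace AsymptoticConjugacy

variable {f h g gi : ℕ → (ℂ × ℂ) → (ℂ × ℂ)} {D c q : ℝ}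

theorem exists_limit (H : AsymptoticConjugacy f h g gi D c q)
    (hf : ∀ n, AnalyticOnNhd ℂ (f n) univ) (hh : ∀ n, AnalyticOnNhd ℂ (h n) univ)
    (hgi : ∀ n, AnalyticOnNhd ℂ (gi n) univ) {M : ℝ} (hM : 0 < M) :
    ∀ᶠ k in atTop, ∃ φ : (ℂ × ℂ) → (ℂ × ℂ), AnalyticOnNhd ℂ φ (ball 0 (M * D ^ k)) ∧
      (∀ x ∈ ball 0 (M * D ^ k), ‖φ x - x‖ ≤ M * D ^ k / 16) ∧
      ∀ x ∈ ball 0 (M * D ^ k), Tendsto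
        (fun n => pullback gi k n (h (k + n) (orbitMap f k n x))) atTop (𝓝 (φ x)) := by
  obtain ⟨K, hK, hev⟩ := H.estimates hM (show 0 < M / 16 by positivity)
  have hr0 : 0 ≤ q / c := (div_pos H.q_pos H.c_pos).le
  have hr1 : q / c < 1 := (div_lt_one H.c_pos).2 H.q_lt
  filter_upwards [hev] with k hk
  set F : ℕ → (ℂ × ℂ) → (ℂ × ℂ) :=
    fun n x => pullback gi k n (h (k + n) (orbitMap f k n x)) with hF
  have hball : ∀ x ∈ ball (0 : ℂ × ℂ) (M * D ^ k), ‖x‖ ≤ M * D ^ k := fun x hx =>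
    (mem_ball_zero_iff.1 hx).le
  have hdist : ∀ x ∈ ball (0 : ℂ × ℂ) (M * D ^ k), ∀ n,
      dist (F n x) (F (n + 1) x) ≤ K * q ^ k * (q / c) ^ n := fun x hx n => by
    rw [dist_comm, dist_eq_norm]
    exact (hk n x (hball x hx)).2
  have hlim : ∀ x, ∃ l, x ∈ ball (0 : ℂ × ℂ) (M * D ^ k) →
      Tendsto (fun n => F n x) atTop (𝓝 l) := by
    intro x
    by_cases hx : x ∈ ball (0 : ℂ × ℂ) (M * D ^ k)
    · obtain ⟨l, hl⟩ := cauchySeq_tendsto_of_complete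
        (cauchySeq_of_le_geometric _ _ hr1 (hdist x hx))
      exact ⟨l, fun _ => hl⟩
    · exact ⟨0, fun h => absurd h hx⟩
  choose φ hφ using hlim
  refine ⟨φ, ?_, ?_, hφ⟩
  · refine analyticOnNhd_of_tendstoUniformlyOn (f := F) isOpen_ball (fun n => ?_) ?_
    · exact ((analyticOnNhd_pullback hgi k n).comp ((hh (k + n)).comp
        (analyticOnNhd_orbitMap hf k n) (mapsTo_univ _ _)) (mapsTo_univ _ _)).mono (subset_univ _)
    · rw [Metric.tendstoUniformlyOn_iff]
      intro ε hε
      have h1 : Tendsto (fun n => K * q ^ k * (q / c) ^ n / (1 - q / c)) atTop (𝓝 0) := by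
        simpa using ((tendsto_pow_atTop_nhds_zero_of_lt_one hr0 hr1).const_mul
          (K * q ^ k)).div_const (1 - q / c)
      filter_upwards [h1.eventually_lt_const hε] with n hn x hx
      rw [dist_comm]
      exact (dist_le_of_le_geometric_of_tendsto _ _ hr1 (hdist x hx) (hφ x hx) n).trans_lt hn
  · intro x hx
    refine le_of_tendsto ((hφ x hx).sub_const x).norm (Eventually.of_forall fun n => ?_)
    exact (hk n x (hball x hx)).1.trans_eq (by ring)

theorem biholomorphicTo_univ (H : AsymptoticConjugacy f h g gi D c q)
    (hf : ∀ n, AnalyticOnNhd ℂ (f n) univ) {fi : ℕ → (ℂ × ℂ) → (ℂ × ℂ)}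
    (hfi : ∀ n, AnalyticOnNhd ℂ (fi n) univ)
    (hfl : ∀ n, Function.LeftInverse (fi n) (f n))
    (hfr : ∀ n, Function.RightInverse (fi n) (f n))
    (hh : ∀ n, AnalyticOnNhd ℂ (h n) univ) (hg : ∀ n, AnalyticOnNhd ℂ (g n) univ)
    (hgi : ∀ n, AnalyticOnNhd ℂ (gi n) univ)
    (hgb : ∀ y, ∃ M, ∀ᶠ k in atTop, ‖orbitMap g 0 k y‖ ≤ M * D ^ k) :
    BiholomorphicTo (basin f) univ := by
  have hD := H.D_pos
  set Φ : (ℂ × ℂ) → (ℂ × ℂ) :=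
    fun x => limUnder atTop (fun n => pullback gi 0 n (h n (orbitMap f 0 n x))) with hΦdef
  have key : ∀ M > 0, ∀ᶠ k : ℕ in atTop, M * D ^ k < 1 ∧ ∃ φ ψ : (ℂ × ℂ) → (ℂ × ℂ),
      AnalyticOnNhd ℂ φ (ball 0 (M * D ^ k)) ∧ InjOn φ (ball 0 (M * D ^ k / 2)) ∧
      AnalyticOnNhd ℂ ψ (ball 0 (M * D ^ k / 8)) ∧
      (∀ y ∈ ball 0 (M * D ^ k / 8), ψ y ∈ ball 0 (M * D ^ k / 2) ∧ φ (ψ y) = y) ∧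
      ∀ x, orbitMap f 0 k x ∈ ball 0 (M * D ^ k) →
        Φ x = pullback gi 0 k (φ (orbitMap f 0 k x)) := by
    intro M hM
    have h1 : Tendsto (fun k : ℕ => M * D ^ k) atTop (𝓝 (M * 0)) :=
      (tendsto_pow_atTop_nhds_zero_of_lt_one hD.le H.D_lt).const_mul M
    rw [mul_zero] at h1
    filter_upwards [h1.eventually_lt_const one_pos, H.exists_limit hf hh hgi hM]
      with k hk ⟨φ, hφ, hφid, hφlim⟩
    obtain ⟨hinj, ψ, hψ, hψφ⟩ := exists_analytic_inverse_of_near_id (by positivity) hφ hφid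
    refine ⟨hk, φ, ψ, hφ, hinj, hψ, hψφ, fun x hx => ?_⟩
    refine Tendsto.limUnder_eq ?_
    rw [← tendsto_add_atTop_iff_nat k]
    have h2 := ((analyticOnNhd_pullback hgi 0 k).continuous.tendsto _).comp (hφlim _ hx)
    refine h2.congr fun n => ?_
    simp only [Function.comp_apply]
    rw [Nat.add_comm n k, pullback_add, orbitMap_add, Nat.zero_add]
  have hgrow : ∀ x ∈ basin f, ∃ M, ∀ᶠ k in atTop, ‖orbitMap f 0 k x‖ ≤ M * D ^ k := fun x hx =>
    exists_norm_orbitMap_le_of_mem_basin hD H.D_lt.le H.contract hx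
  have hlt : ∀ {u : ℕ → ℂ × ℂ} {M : ℝ} (a : ℝ), 0 < a → (∀ᶠ k in atTop, ‖u k‖ ≤ M * D ^ k) →
      ∀ M', a * (|M| + 1) ≤ M' → ∀ᶠ k in atTop, u k ∈ ball 0 (M' * D ^ k / a) := by
    intro u M a ha hu M' hM'
    filter_upwards [hu] with k hk
    rw [mem_ball_zero_iff, lt_div_iff₀ ha]
    have h1 : M * D ^ k < (|M| + 1) * D ^ k := by
      gcongr
      exact (le_abs_self M).trans_lt (lt_add_one _)
    calc ‖u k‖ * a < (|M| + 1) * D ^ k * a := by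
          gcongr
          exact hk.trans_lt h1
      _ = a * (|M| + 1) * D ^ k := by ring
      _ ≤ M' * D ^ k := by gcongr
  have hginj : ∀ k, Function.Injective (pullback gi 0 k) := fun k =>
    (show Function.LeftInverse (orbitMap g 0 k) (pullback gi 0 k) from
      fun y => orbitMap_pullback H.right_inv 0 k y).injective
  have hfinj : ∀ k, Function.Injective (orbitMap f 0 k) := fun k =>
    (show Function.LeftInverse (pullback fi 0 k) (orbitMap f 0 k) from
      fun y => pullback_orbitMap hfl 0 k y).injective
  have hΦinj : InjOn Φ (basin f) := by
    intro x hx x' hx' hxx'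
    obtain ⟨M₁, hM₁⟩ := hgrow x hx
    obtain ⟨M₂, hM₂⟩ := hgrow x' hx'
    set M := 2 * (|M₁| + |M₂| + 1) with hM
    have hM0 : 0 < M := by positivity
    obtain ⟨k, ⟨-, φ, ψ, -, hinj, -, -, hφ⟩, h1, h2⟩ := ((key M hM0).and
      ((hlt 2 two_pos hM₁ M (by linarith [abs_nonneg M₂])).and
        (hlt 2 two_pos hM₂ M (by linarith [abs_nonneg M₁])))).exists
    have hsub : ball (0 : ℂ × ℂ) (M * D ^ k / 2) ⊆ ball 0 (M * D ^ k) :=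
      ball_subset_ball (half_le_self (by positivity))
    rw [hφ x (hsub h1), hφ x' (hsub h2)] at hxx'
    exact hfinj k (hinj h1 h2 (hginj k hxx'))
  have hsurj : ∀ y, ∃ χ : (ℂ × ℂ) → (ℂ × ℂ), AnalyticAt ℂ χ y ∧
      ∀ᶠ z in 𝓝 y, χ z ∈ basin f ∧ Φ (χ z) = z := by
    intro y
    obtain ⟨M₁, hM₁⟩ := hgb y
    set M := 8 * (|M₁| + 1) with hM
    have hM0 : 0 < M := by positivity
    obtain ⟨k, ⟨hk1, φ, ψ, -, -, hψ, hψφ, hφ⟩, h1⟩ := ((key M hM0).and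
      (hlt 8 (by norm_num) hM₁ M le_rfl)).exists
    refine ⟨fun z => pullback fi 0 k (ψ (orbitMap g 0 k z)), ?_, ?_⟩
    · exact (analyticOnNhd_pullback hfi 0 k _ trivial).comp
        ((hψ _ h1).comp (analyticOnNhd_orbitMap hg 0 k y trivial))
    · have h2 := ((analyticOnNhd_orbitMap hg 0 k).continuous.tendsto y).eventually
        (isOpen_ball.mem_nhds h1)
      filter_upwards [h2] with z hz
      obtain ⟨h3, h4⟩ := hψφ _ hz
      have h5 : orbitMap f 0 k (pullback fi 0 k (ψ (orbitMap g 0 k z))) =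
        ψ (orbitMap g 0 k z) := orbitMap_pullback hfr _ _ _
      have h6 : ψ (orbitMap g 0 k z) ∈ ball 0 (M * D ^ k) :=
        ball_subset_ball (half_le_self (by positivity)) h3
      refine ⟨mem_basin_of_norm_lt hD.le H.D_lt H.contract (k := k) ?_, ?_⟩
      · rw [h5]
        exact (mem_ball_zero_iff.1 h6).trans hk1
      · rw [hφ _ (by rwa [h5]), h5, h4]
        exact pullback_orbitMap H.left_inv _ _ _
  have hsurjOn : SurjOn Φ (basin f) univ := fun y _ => by
    obtain ⟨χ, -, hχ⟩ := hsurj y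
    exact ⟨χ y, hχ.self_of_nhds⟩
  set Ψ := Function.invFunOn Φ (basin f) with hΨ
  have hΨmem : ∀ y, Ψ y ∈ basin f := fun y => Function.invFunOn_mem (hsurjOn (mem_univ y))
  have hΨeq : ∀ y, Φ (Ψ y) = y := fun y => Function.invFunOn_eq (hsurjOn (mem_univ y))
  refine ⟨Φ, Ψ, ?_, ?_, mapsTo_univ _ _, fun y _ => hΨmem y, fun x hx => ?_, fun y _ => hΨeq y⟩
  · refine AnalyticOnNhd.analyticOn fun x hx => ?_
    obtain ⟨M₁, hM₁⟩ := hgrow x hx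
    set M := 1 * (|M₁| + 1) with hM
    have hM0 : 0 < M := by positivity
    obtain ⟨k, ⟨-, φ, ψ, hφa, -, -, -, hφ⟩, h1⟩ := ((key M hM0).and
      (hlt 1 one_pos hM₁ M le_rfl)).exists
    rw [div_one] at h1
    have ha : AnalyticAt ℂ (fun x => pullback gi 0 k (φ (orbitMap f 0 k x))) x :=
      (analyticOnNhd_pullback hgi 0 k _ trivial).comp
        ((hφa _ h1).comp (analyticOnNhd_orbitMap hf 0 k x trivial))
    refine ha.congr ?_
    filter_upwards [((analyticOnNhd_orbitMap hf 0 k).continuous.tendsto x).eventually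
      (isOpen_ball.mem_nhds h1)] with z hz
    exact (hφ z hz).symm
  · refine AnalyticOnNhd.analyticOn fun y _ => ?_
    obtain ⟨χ, hχa, hχ⟩ := hsurj y
    refine hχa.congr ?_
    filter_upwards [hχ] with z hz
    exact hΦinj hz.1 (hΨmem z) (hz.2.trans (hΨeq z).symm)
  · exact hΦinj (hΨmem _) hx (hΨeq _)

end AsymptoticConjugacy

section Taylor

variable {E F : Type*} [NormedAddCommGroup E] [NormedSpace ℂ E]
  [NormedAddCommGroup F] [NormedSpace ℂ F]

theorem norm_sub_le_of_fderiv_bound {ψ : E → F} {ψ' : E → E →L[ℂ] F} {x : E} {K : ℝ} {n : ℕ}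
    (hK : 0 ≤ K) (hψ : ∀ y, ‖y‖ ≤ ‖x‖ → HasFDerivAt ψ (ψ' y) y)
    (hb : ∀ y, ‖y‖ ≤ ‖x‖ → ‖ψ' y‖ ≤ K * ‖y‖ ^ n) : ‖ψ x - ψ 0‖ ≤ K * ‖x‖ ^ (n + 1) := by
  have h1 := (convex_closedBall (0 : E) ‖x‖).norm_image_sub_le_of_norm_hasFDerivWithin_le
    (f := ψ) (f' := ψ') (C := K * ‖x‖ ^ n) (x := 0) (y := x) (𝕜 := ℂ)
    (fun y hy => (hψ y (mem_closedBall_zero_iff.1 hy)).hasFDerivWithinAt)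
    (fun y hy => (hb y (mem_closedBall_zero_iff.1 hy)).trans (by
      have := mem_closedBall_zero_iff.1 hy
      gcongr))
    (mem_closedBall_self (norm_nonneg _)) (mem_closedBall_zero_iff.2 le_rfl)
  rw [sub_zero] at h1
  exact h1.trans_eq (by ring)

theorem norm_fderiv_le_on_ball {ψ : E → F} {r s M : ℝ} (hr : 0 < s - r)
    (hψ : DifferentiableOn ℂ ψ (ball 0 s)) (hM : ∀ x ∈ ball (0 : E) s, ‖ψ x‖ ≤ M) :
    ∀ x ∈ ball (0 : E) r, ‖fderiv ℂ ψ x‖ ≤ 2 * M / (s - r) := by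
  intro x hx
  have hsub : ball x (s - r) ⊆ ball 0 s := ball_subset (by
    rw [mem_ball] at hx
    rw [sub_sub_cancel]
    exact hx.le)
  exact norm_fderiv_le_of_norm_le hr (hψ.mono hsub) fun y hy => hM y (hsub hy)

theorem norm_sub_le_of_bounded_ball [CompleteSpace F] {ψ : E → F} {M : ℝ} (hM : 0 ≤ M)
    (hψ : AnalyticOnNhd ℂ ψ (ball 0 1)) (hb : ∀ x ∈ ball (0 : E) (5 / 8), ‖ψ x‖ ≤ M) {x : E}
    (hx : ‖x‖ ≤ 1 / 2) : ‖ψ x - ψ 0‖ ≤ 32 * M * ‖x‖ := by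
  have hb' : ∀ x ∈ ball (0 : E) (9 / 16), ‖fderiv ℂ ψ x‖ ≤ 32 * M := fun x hx =>
    (norm_fderiv_le_on_ball (by norm_num) (hψ.differentiableOn.mono
      (ball_subset_ball (by norm_num))) hb x hx).trans_eq (by ring)
  have := norm_sub_le_of_fderiv_bound (n := 0) (ψ := ψ) (ψ' := fderiv ℂ ψ) (x := x) (K := 32 * M)
    (by positivity)
    (fun y hy => (hψ y (mem_ball_zero_iff.2 ((hy.trans hx).trans_lt
      (by norm_num)))).differentiableAt.hasFDerivAt)
    (fun y hy => (hb' y (mem_ball_zero_iff.2 ((hy.trans hx).trans_lt (by norm_num)))).trans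
      (by simp))
  simpa using this

/-- A holomorphic map bounded by `1` on the unit ball has a second order Taylor expansion at the
origin with universal bounds. -/
theorem exists_norm_sub_taylor_le [CompleteSpace F] {f : E → F} (hf : AnalyticOnNhd ℂ f (ball 0 1))
    (h0 : f 0 = 0) (hb : ∀ x ∈ ball (0 : E) 1, ‖f x‖ ≤ 1) :
    ∃ Q : E →L[ℂ] E →L[ℂ] F, ‖Q‖ ≤ 4096 ∧
      ∀ x, ‖x‖ ≤ 1 / 2 → ‖f x - fderiv ℂ f 0 x - Q x x‖ ≤ 4096 * ‖x‖ ^ 3 := by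
  set f1 := fderiv ℂ f with hf1
  set f2 := fderiv ℂ f1 with hf2
  have ha1 : AnalyticOnNhd ℂ f1 (ball 0 1) := hf.fderiv
  have ha2 : AnalyticOnNhd ℂ f2 (ball 0 1) := ha1.fderiv
  have hb1 : ∀ x ∈ ball (0 : E) (3 / 4), ‖f1 x‖ ≤ 8 := fun x hx =>
    (norm_fderiv_le_on_ball (by norm_num) hf.differentiableOn hb x hx).trans (by norm_num)
  have hb2 : ∀ x ∈ ball (0 : E) (5 / 8), ‖f2 x‖ ≤ 128 := fun x hx =>
    (norm_fderiv_le_on_ball (by norm_num) (ha1.differentiableOn.mono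
      (ball_subset_ball (by norm_num))) hb1 x hx).trans (by norm_num)
  have hmem : ∀ x : E, ‖x‖ ≤ 1 / 2 → x ∈ ball (0 : E) 1 := fun x hx =>
    mem_ball_zero_iff.2 (hx.trans_lt (by norm_num))
  have e2 : ∀ x, ‖x‖ ≤ 1 / 2 → ‖f2 x - f2 0‖ ≤ 4096 * ‖x‖ := by
    intro x hx
    exact (norm_sub_le_of_bounded_ball (by norm_num) ha2 hb2 hx).trans_eq (by ring)
  have e1 : ∀ x, ‖x‖ ≤ 1 / 2 → ‖f1 x - f1 0 - f2 0 x‖ ≤ 4096 * ‖x‖ ^ 2 := by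
    intro x hx
    have := norm_sub_le_of_fderiv_bound (n := 1) (ψ := fun y => f1 y - f2 0 y)
      (ψ' := fun y => f2 y - f2 0) (x := x) (K := 4096)
      (by norm_num) (fun y hy => (ha1 y (hmem y (hy.trans hx))).differentiableAt.hasFDerivAt.sub
        (f2 0).hasFDerivAt)
      (fun y hy => (e2 y (hy.trans hx)).trans (by simp))
    refine le_of_eq_of_le ?_ this
    congr 1
    simp only [map_zero, sub_zero]
    abel
  have hsymm : ∀ v w, f2 0 v w = f2 0 w v := by
    have h1 : ∀ᶠ y in 𝓝 (0 : E), HasFDerivAt f (f1 y) y := by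
      filter_upwards [ball_mem_nhds (0 : E) one_pos] with y hy
      exact (hf y hy).differentiableAt.hasFDerivAt
    exact fun v w => second_derivative_symmetric_of_eventually h1
      (ha1 0 (mem_ball_self one_pos)).differentiableAt.hasFDerivAt v w
  refine ⟨(1 / 2 : ℂ) • f2 0, ?_, fun x hx => ?_⟩
  · refine (ContinuousLinearMap.opNorm_smul_le _ _).trans ?_
    have := hb2 0 (mem_ball_self (by norm_num))
    norm_num
    linarith
  · have := norm_sub_le_of_fderiv_bound (n := 2)
      (ψ := fun y => f y - f1 0 y - ((1 / 2 : ℂ) • f2 0) y y)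
      (ψ' := fun y => f1 y - f1 0 - f2 0 y) (x := x) (K := 4096) (by norm_num) (fun y hy => ?_)
      (fun y hy => e1 y (hy.trans hx))
    · simpa [h0] using this
    · have h1 := (hf y (hmem y (hy.trans hx))).differentiableAt.hasFDerivAt
      have h2 := (((1 / 2 : ℂ) • f2 0).hasFDerivAt (x := y)).clm_apply (hasFDerivAt_id y)
      have h3 := (h1.sub (f1 0).hasFDerivAt).sub h2
      refine h3.congr_fderiv ?_
      ext v
      simp [hsymm v y]
      rw [← add_smul]
      norm_num [hf1]

end Taylor

/-- The homogeneous quadratic map of `ℂ × ℂ` with the given coefficients. -/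
def quadEval (σ : Fin 6 → ℂ) (x y : ℂ) : ℂ × ℂ :=
  (σ 0 * x ^ 2 + σ 1 * (x * y) + σ 2 * y ^ 2, σ 3 * x ^ 2 + σ 4 * (x * y) + σ 5 * y ^ 2)

/-- The coefficients of `A⁻¹ (σ ∘ A + Q)` where `A (x, y) = (a x, c x + b y)`. -/
def quadPull (a b c : ℂ) (Q σ : Fin 6 → ℂ) : Fin 6 → ℂ :=
  ![(σ 0 * a ^ 2 + σ 1 * (a * c) + σ 2 * c ^ 2 + Q 0) / a,
    (σ 1 * (a * b) + 2 * σ 2 * (b * c) + Q 1) / a,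
    (σ 2 * b ^ 2 + Q 2) / a,
    (σ 3 * a ^ 2 + σ 4 * (a * c) + σ 5 * c ^ 2 + Q 3 -
      c * ((σ 0 * a ^ 2 + σ 1 * (a * c) + σ 2 * c ^ 2 + Q 0) / a)) / b,
    (σ 4 * (a * b) + 2 * σ 5 * (b * c) + Q 4 -
      c * ((σ 1 * (a * b) + 2 * σ 2 * (b * c) + Q 1) / a)) / b,
    (σ 5 * b ^ 2 + Q 5 - c * ((σ 2 * b ^ 2 + Q 2) / a)) / b]

theorem quadEval_quadPull {a b : ℂ} (c : ℂ) (ha : a ≠ 0) (hb : b ≠ 0) (Q σ : Fin 6 → ℂ)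
    (x y : ℂ) :
    quadEval σ (a * x) (c * x + b * y) + quadEval Q x y =
      (a * (quadEval (quadPull a b c Q σ) x y).1,
        c * (quadEval (quadPull a b c Q σ) x y).1 + b * (quadEval (quadPull a b c Q σ) x y).2) := by
  ext
  · simp [quadEval, quadPull]
    field_simp
    ring
  · simp [quadEval, quadPull]
    field_simp
    ring

/-- The coefficients of a quadratic map after the coordinate change
`(x, y) ↦ (κ y, x + τ y)`. -/
def quadFrame (κ τ : ℂ) (σ : Fin 6 → ℂ) : Fin 6 → ℂ :=
  ![σ 5 - τ / κ * σ 2,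
    (σ 4 * κ + 2 * σ 5 * τ) - τ / κ * (σ 1 * κ + 2 * σ 2 * τ),
    (σ 3 * κ ^ 2 + σ 4 * (κ * τ) + σ 5 * τ ^ 2) -
      τ / κ * (σ 0 * κ ^ 2 + σ 1 * (κ * τ) + σ 2 * τ ^ 2),
    σ 2 / κ,
    (σ 1 * κ + 2 * σ 2 * τ) / κ,
    (σ 0 * κ ^ 2 + σ 1 * (κ * τ) + σ 2 * τ ^ 2) / κ]

theorem quadEval_quadFrame {κ : ℂ} (hκ : κ ≠ 0) (τ : ℂ) (σ : Fin 6 → ℂ) (x y : ℂ) :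
    quadEval σ (κ * y) (x + τ * y) =
      (κ * (quadEval (quadFrame κ τ σ) x y).2,
        (quadEval (quadFrame κ τ σ) x y).1 + τ * (quadEval (quadFrame κ τ σ) x y).2) := by
  ext
  · simp [quadEval, quadFrame]
    field_simp
    ring
  · simp [quadEval, quadFrame]
    field_simp
    ring

/-- The value of the coefficient of index `3` for which the coefficient of index `2` vanishes
after the coordinate change. -/
def quadKill (κ τ : ℂ) (σ : Fin 6 → ℂ) : ℂ :=
  (τ / κ * (σ 0 * κ ^ 2 + σ 1 * (κ * τ) + σ 2 * τ ^ 2) - (σ 4 * (κ * τ) + σ 5 * τ ^ 2)) / κ ^ 2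

theorem quadFrame_update_quadKill {κ : ℂ} (hκ : κ ≠ 0) (τ : ℂ) (σ : Fin 6 → ℂ) :
    quadFrame κ τ (Function.update σ 3 (quadKill κ τ σ)) 2 = 0 := by
  simp [quadFrame, quadKill, Function.update]
  field_simp
  ring

theorem norm_quadFrame_le {κ τ : ℂ} (hκ : 1 / 2 ≤ ‖κ‖) (hκ1 : ‖κ‖ ≤ 1) (hτ : ‖τ‖ ≤ 2)
    {σ : Fin 6 → ℂ} {M : ℝ} (hσ : ∀ i, ‖σ i‖ ≤ M) (i : Fin 6) :
    ‖quadFrame κ τ σ i‖ ≤ 100 * M := by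
  have hM : 0 ≤ M := (norm_nonneg _).trans (hσ 0)
  have hκ0 : κ ≠ 0 := norm_pos_iff.1 (by linarith)
  have hi : ‖κ⁻¹‖ ≤ 2 := by
    rw [norm_inv]
    exact inv_le_of_inv_le₀ two_pos (by linarith)
  have hP : ‖σ 0 * κ ^ 2 + σ 1 * (κ * τ) + σ 2 * τ ^ 2‖ ≤ 7 * M := by
    refine norm_add₃_le.trans ?_
    simp only [norm_mul, norm_pow]
    calc _ ≤ M * 1 ^ 2 + M * (1 * 2) + M * 2 ^ 2 := by gcongr <;> apply hσ
      _ = 7 * M := by ring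
  have hQ : ‖σ 3 * κ ^ 2 + σ 4 * (κ * τ) + σ 5 * τ ^ 2‖ ≤ 7 * M := by
    refine norm_add₃_le.trans ?_
    simp only [norm_mul, norm_pow]
    calc _ ≤ M * 1 ^ 2 + M * (1 * 2) + M * 2 ^ 2 := by gcongr <;> apply hσ
      _ = 7 * M := by ring
  have hR : ‖σ 1 * κ + 2 * σ 2 * τ‖ ≤ 5 * M := by
    refine (norm_add_le _ _).trans ?_
    simp only [norm_mul, Complex.norm_two]
    calc _ ≤ M * 1 + 2 * M * 2 := by gcongr <;> apply hσ
      _ = 5 * M := by ring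
  have hS : ‖σ 4 * κ + 2 * σ 5 * τ‖ ≤ 5 * M := by
    refine (norm_add_le _ _).trans ?_
    simp only [norm_mul, Complex.norm_two]
    calc _ ≤ M * 1 + 2 * M * 2 := by gcongr <;> apply hσ
      _ = 5 * M := by ring
  have hq : ‖τ / κ‖ ≤ 4 := by
    rw [div_eq_mul_inv, norm_mul]
    calc _ ≤ (2 : ℝ) * 2 := by gcongr
      _ = 4 := by norm_num
  have key : ∀ {z w : ℂ} {B B' : ℝ}, ‖z‖ ≤ B → ‖w‖ ≤ B' → ‖z - τ / κ * w‖ ≤ B + 4 * B' := by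
    intro z w B B' hz hw
    refine (norm_sub_le _ _).trans (add_le_add hz ?_)
    rw [norm_mul]
    have : 0 ≤ B' := (norm_nonneg _).trans hw
    gcongr
  have key2 : ∀ {w : ℂ} {B' : ℝ}, ‖w‖ ≤ B' → ‖w / κ‖ ≤ 2 * B' := by
    intro w B' hw
    rw [div_eq_mul_inv, norm_mul, mul_comm]
    gcongr
  fin_cases i
  · exact (key (hσ 5) (hσ 2)).trans (by linarith)
  · exact (key hS hR).trans (by linarith)
  · exact (key hQ hP).trans (by linarith)
  · exact (key2 (hσ 2)).trans (by linarith)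
  · exact (key2 hR).trans (by linarith)
  · exact (key2 hP).trans (by linarith)

theorem norm_quadKill_le {κ τ : ℂ} (hκ : 1 / 2 ≤ ‖κ‖) (hκ1 : ‖κ‖ ≤ 1) (hτ : ‖τ‖ ≤ 2)
    {σ : Fin 6 → ℂ} {M : ℝ} (hσ : ∀ i, i ≠ 3 → ‖σ i‖ ≤ M) :
    ‖quadKill κ τ σ‖ ≤ 400 * M := by
  have hM : 0 ≤ M := (norm_nonneg _).trans (hσ 0 (by decide))
  have hκ0 : κ ≠ 0 := norm_pos_iff.1 (by linarith)
  have hi : ‖κ⁻¹‖ ≤ 2 := by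
    rw [norm_inv]
    exact inv_le_of_inv_le₀ two_pos (by linarith)
  have h := norm_quadFrame_le hκ hκ1 hτ (σ := Function.update σ 3 0) (M := M) (fun i => by
    by_cases hi : i = 3
    · simp [hi, hM]
    · simp [hi, hσ]) 2
  have e : quadKill κ τ σ = - quadFrame κ τ (Function.update σ 3 0) 2 * (κ⁻¹ * κ⁻¹) := by
    simp [quadFrame, quadKill, Function.update]
    field_simp
  rw [e, norm_mul, norm_mul, norm_neg]
  calc _ ≤ 100 * M * (2 * 2) := by gcongr
    _ = 400 * M := by ring

theorem norm_quadPull_le {C D K₀ : ℝ} (hC : 0 < C) (hC1 : C ≤ 1) (hD1 : D ≤ 1) {a b c : ℂ}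
    (hCa : C ≤ ‖a‖) (haD : ‖a‖ ≤ D) (hCb : C ≤ ‖b‖) (hbD : ‖b‖ ≤ D) (hc : ‖c‖ ≤ 2)
    {Q σ : Fin 6 → ℂ} {M : ℝ} (hQ : ∀ i, ‖Q i‖ ≤ K₀) (hσ : ∀ i, ‖σ i‖ ≤ M) (i : Fin 6) :
    ‖quadPull a b c Q σ i‖ ≤ 100 / C ^ 2 * (M + K₀) := by
  have hM : 0 ≤ M := (norm_nonneg _).trans (hσ 0)
  have hK : 0 ≤ K₀ := (norm_nonneg _).trans (hQ 0)
  have ha1 := haD.trans hD1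
  have hb1 := hbD.trans hD1
  have hai : ∀ {z : ℂ} {B : ℝ}, ‖z‖ ≤ B → ‖z / a‖ ≤ B / C := fun h => by
    rw [norm_div]
    exact div_le_div₀ ((norm_nonneg _).trans h) h hC hCa
  have hbi : ∀ {z : ℂ} {B : ℝ}, ‖z‖ ≤ B → ‖z / b‖ ≤ B / C := fun h => by
    rw [norm_div]
    exact div_le_div₀ ((norm_nonneg _).trans h) h hC hCb
  have hbi2 : ∀ {z w : ℂ} {B : ℝ}, ‖z‖ ≤ B → ‖w‖ ≤ B / C → ‖(z - c * w) / b‖ ≤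
      3 * B / C ^ 2 := fun {z w B} h h' => by
    have hB : 0 ≤ B := (norm_nonneg _).trans h
    have : ‖z - c * w‖ ≤ 3 * B / C := by
      refine (norm_sub_le _ _).trans ?_
      rw [norm_mul]
      calc _ ≤ B + 2 * (B / C) := by gcongr
        _ ≤ B / C + 2 * (B / C) := by
          gcongr
          rw [le_div_iff₀ hC]
          nlinarith
        _ = 3 * B / C := by ring
    exact (hbi this).trans_eq (by field_simp)
  have t1 : ∀ x y z k : ℂ, ‖x‖ ≤ M → ‖y‖ ≤ M → ‖z‖ ≤ M → ‖k‖ ≤ K₀ →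
      ‖x * a ^ 2 + y * (a * c) + z * c ^ 2 + k‖ ≤ 7 * (M + K₀) := by
    intro x y z k hx hy hz hk
    refine (norm_add_le _ _).trans ((add_le_add_left norm_add₃_le _).trans ?_)
    simp only [norm_mul, norm_pow]
    calc _ ≤ M * 1 ^ 2 + M * (1 * 2) + M * 2 ^ 2 + K₀ := by gcongr
      _ ≤ 7 * (M + K₀) := by linarith
  have t2 : ∀ y z k : ℂ, ‖y‖ ≤ M → ‖z‖ ≤ M → ‖k‖ ≤ K₀ →
      ‖y * (a * b) + 2 * z * (b * c) + k‖ ≤ 7 * (M + K₀) := by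
    intro y z k hy hz hk
    refine norm_add₃_le.trans ?_
    simp only [norm_mul, Complex.norm_two]
    calc _ ≤ M * (1 * 1) + 2 * M * (1 * 2) + K₀ := by gcongr
      _ ≤ 7 * (M + K₀) := by linarith
  have t3 : ∀ z k : ℂ, ‖z‖ ≤ M → ‖k‖ ≤ K₀ → ‖z * b ^ 2 + k‖ ≤ 7 * (M + K₀) := by
    intro z k hz hk
    refine (norm_add_le _ _).trans ?_
    simp only [norm_mul, norm_pow]
    calc _ ≤ M * 1 ^ 2 + K₀ := by gcongr
      _ ≤ 7 * (M + K₀) := by linarith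
  have hS : 0 ≤ M + K₀ := by positivity
  have f1 : 7 * (M + K₀) / C ≤ 100 / C ^ 2 * (M + K₀) := by
    rw [div_le_iff₀ hC, div_mul_eq_mul_div, div_mul_eq_mul_div, le_div_iff₀ (by positivity)]
    have : C * C ≤ 1 * C := by gcongr
    nlinarith [mul_nonneg hS hC.le]
  have f2 : 3 * (7 * (M + K₀)) / C ^ 2 ≤ 100 / C ^ 2 * (M + K₀) := by
    rw [div_mul_eq_mul_div]
    exact div_le_div_of_nonneg_right (by linarith) (by positivity)
  fin_cases i
  · exact (hai (t1 _ _ _ _ (hσ 0) (hσ 1) (hσ 2) (hQ 0))).trans f1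
  · exact (hai (t2 _ _ _ (hσ 1) (hσ 2) (hQ 1))).trans f1
  · exact (hai (t3 _ _ (hσ 2) (hQ 2))).trans f1
  · exact (hbi2 (t1 _ _ _ _ (hσ 3) (hσ 4) (hσ 5) (hQ 3))
      (hai (t1 _ _ _ _ (hσ 0) (hσ 1) (hσ 2) (hQ 0)))).trans f2
  · exact (hbi2 (t2 _ _ _ (hσ 4) (hσ 5) (hQ 4)) (hai (t2 _ _ _ (hσ 1) (hσ 2) (hQ 1)))).trans f2
  · exact (hbi2 (t3 _ _ (hσ 5) (hQ 5)) (hai (t3 _ _ (hσ 2) (hQ 2)))).trans f2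

theorem le_of_affine_recursion {ρ δ ω H V : ℝ} (hρ : 0 ≤ ρ) (hρδ : ρ < δ) (hδω : δ ≤ ω)
    (hH : 0 ≤ H) (hV : 0 ≤ V) {y : ℕ → ℝ} {L : ℕ} {K : ℝ} (hK : 1 + H / (δ - ρ) ≤ K)
    (h0 : y 0 ≤ V)
    (hy : ∀ l < L, y (l + 1) ≤ ρ * y l + H * (ω ^ l + V * δ ^ l)) :
    ∀ l ≤ L, y l ≤ K * (ω ^ l + V * δ ^ l) := by
  have hδρ : 0 < δ - ρ := sub_pos.2 hρδ
  have hH' : 0 ≤ H / (δ - ρ) := by positivity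
  have hδ : 0 < δ := hρ.trans_lt hρδ
  have hω : 0 < ω := hδ.trans_le hδω
  have hKH : ρ * K + H ≤ δ * K := by
    have : H / (δ - ρ) ≤ K := by linarith
    rw [div_le_iff₀ hδρ] at this
    linarith
  intro l
  induction l with
  | zero =>
    intro _
    rw [pow_zero, pow_zero, mul_one]
    nlinarith
  | succ l ih =>
    intro hl
    have h1 := ih (by omega)
    have hp : 0 ≤ ω ^ l + V * δ ^ l := by positivity
    calc y (l + 1) ≤ ρ * y l + H * (ω ^ l + V * δ ^ l) := hy l (by omega)
      _ ≤ ρ * (K * (ω ^ l + V * δ ^ l)) + H * (ω ^ l + V * δ ^ l) := by gcongr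
      _ = (ρ * K + H) * (ω ^ l + V * δ ^ l) := by ring
      _ ≤ (δ * K) * (ω ^ l + V * δ ^ l) := by gcongr
      _ = K * (δ * ω ^ l + V * δ ^ (l + 1)) := by ring
      _ ≤ K * (ω ^ (l + 1) + V * δ ^ (l + 1)) := by
        have : 0 ≤ K := by linarith
        rw [pow_succ' ω]
        gcongr

set_option maxHeartbeats 1000000 in
/-- Bounds for the coefficients pulled back along a stretch of the sequence at whose end the
coefficient of index `2` vanishes. -/
theorem exists_quadPull_stretch_bound {C D δ ω K₀ : ℝ} (hC : 0 < C) (hCD : C ≤ D) (hDδ : D < δ)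
    (hδ : δ ≤ 1) (hω : 1 < ω) (hω' : D ^ 2 / C < ω) (hK₀ : 0 ≤ K₀) :
    ∃ K, 1 ≤ K ∧ ∀ (V : ℝ) (L : ℕ) (a b c : ℕ → ℂ) (Q σ : ℕ → Fin 6 → ℂ), 0 ≤ V →
      (∀ l, C ≤ ‖a l‖ ∧ ‖a l‖ ≤ D) → (∀ l, C ≤ ‖b l‖ ∧ ‖b l‖ ≤ D) → (∀ l, ‖c l‖ ≤ 2) →
      (∀ l i, ‖Q l i‖ ≤ K₀) → σ 0 2 = 0 → (∀ i, i ≠ 3 → ‖σ 0 i‖ ≤ V) →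
      (∀ l < L, ∀ i, i ≠ 3 → σ (l + 1) i = quadPull (a l) (b l) (c l) (Q l) (σ l) i) →
      ∀ l ≤ L, ∀ i, i ≠ 3 → ‖σ l i‖ ≤ K * (ω ^ l + V * δ ^ l) := by
  have hD : 0 < D := hC.trans_le hCD
  have hD1 : D ≤ 1 := hDδ.le.trans hδ
  have hδ0 : 0 < δ := hD.trans hDδ
  have hω0 : 0 < ω := one_pos.trans hω
  have hδω : δ ≤ ω := hδ.trans hω.le
  have hδD : 0 < δ - D := sub_pos.2 hDδ
  have hωD : 0 < ω - D ^ 2 / C := sub_pos.2 hω'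
  set K₁ := K₀ / C / (ω - D ^ 2 / C) with hK₁
  have hK₁0 : 0 ≤ K₁ := by positivity
  have hK₁C : D ^ 2 / C * K₁ + K₀ / C = ω * K₁ := by
    have : K₁ * (ω - D ^ 2 / C) = K₀ / C := div_mul_cancel₀ _ hωD.ne'
    linarith
  set Hx := (K₀ + 2 * (ω * K₁)) / C with hHx
  set Hq := (4 * K₁ + K₀) / C with hHq
  have hHx0 : 0 ≤ Hx := by positivity
  have hHq0 : 0 ≤ Hq := by positivity
  set K₂ := 1 + (Hx + Hq) / (δ - D) with hK₂
  have hK₂0 : 1 ≤ K₂ := le_add_of_nonneg_right (by positivity)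
  set Ht := (4 * K₂ + K₀ + 2 * (ω * K₂)) / C with hHt
  set Hp := (2 * K₂ + 4 * K₁ + K₀) / C with hHp
  have hHt0 : 0 ≤ Ht := by positivity
  have hHp0 : 0 ≤ Hp := by positivity
  set K₃ := 1 + (Ht + Hp) / (δ - D) with hK₃
  have hK₃0 : 1 ≤ K₃ := le_add_of_nonneg_right (by positivity)
  refine ⟨K₁ + K₂ + K₃, by linarith, ?_⟩
  intro V L a b c Q σ hV ha hb hc hQ h2 hσ0 hrec
  have hE1 : ∀ l, 1 ≤ ω ^ l + V * δ ^ l := fun l =>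
    le_add_of_le_of_nonneg (one_le_pow₀ hω.le) (by positivity)
  have hEω : ∀ l, ω ^ l ≤ ω ^ l + V * δ ^ l := fun l => le_add_of_nonneg_right (by positivity)
  have hEs : ∀ l, ω ^ (l + 1) + V * δ ^ (l + 1) ≤ ω * (ω ^ l + V * δ ^ l) := fun l => by
    rw [pow_succ', pow_succ', mul_add]
    have : δ * δ ^ l ≤ ω * δ ^ l := by gcongr
    nlinarith
  have ha0 : ∀ l, 0 < ‖a l‖ := fun l => hC.trans_le (ha l).1
  have hb0 : ∀ l, 0 < ‖b l‖ := fun l => hC.trans_le (hb l).1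
  have ha1 : ∀ l, ‖a l‖ ≤ 1 := fun l => (ha l).2.trans hD1
  have hb1 : ∀ l, ‖b l‖ ≤ 1 := fun l => (hb l).2.trans hD1
  -- the coefficient of index `2`
  have hr : ∀ l ≤ L, ‖σ l 2‖ ≤ K₁ * ω ^ l := by
    intro l
    induction l with
    | zero => intro _; simpa [h2] using hK₁0
    | succ l ih =>
      intro hl
      rw [hrec l (by omega) 2 (by decide)]
      simp only [quadPull, Matrix.cons_val]
      rw [norm_div, div_le_iff₀ (ha0 l)]
      calc _ ≤ ‖σ l 2‖ * ‖b l‖ ^ 2 + ‖Q l 2‖ := by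
            refine (norm_add_le _ _).trans_eq ?_
            rw [norm_mul, norm_pow]
        _ ≤ K₁ * ω ^ l * D ^ 2 + K₀ * ω ^ l := by
            have h3 := ih (by omega)
            have h4 := (hb l).2
            have h5 : ‖Q l 2‖ ≤ K₀ * ω ^ l :=
              (hQ l 2).trans (le_mul_of_one_le_right hK₀ (one_le_pow₀ hω.le))
            gcongr
        _ = (D ^ 2 / C * K₁ + K₀ / C) * ω ^ l * C := by field_simp
        _ = K₁ * ω ^ (l + 1) * C := by rw [hK₁C]; ring
        _ ≤ K₁ * ω ^ (l + 1) * ‖a l‖ := by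
          have := (ha l).1
          gcongr
  have hr' : ∀ l ≤ L, ‖σ l 2‖ ≤ K₁ * (ω ^ l + V * δ ^ l) := fun l hl =>
    (hr l hl).trans (by gcongr; exact hEω l)
  have hQE : ∀ l i, ‖Q l i‖ ≤ K₀ * (ω ^ l + V * δ ^ l) := fun l i =>
    (hQ l i).trans (le_mul_of_one_le_right hK₀ (hE1 l))
  -- the coefficient of index `5`
  have hx : ∀ l ≤ L, ‖σ l 5‖ ≤ K₂ * (ω ^ l + V * δ ^ l) := by
    refine le_of_affine_recursion hD.le hDδ hδω hHx0 hV ?_ (hσ0 5 (by decide)) ?_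
    · rw [hK₂]
      gcongr
      linarith
    intro l hl
    have e : σ (l + 1) 5 = σ l 5 * b l + (Q l 5 - c l * σ (l + 1) 2) / b l := by
      rw [hrec l hl 5 (by decide), hrec l hl 2 (by decide)]
      simp only [quadPull, Matrix.cons_val]
      have := norm_pos_iff.1 (hb0 l)
      field_simp
      ring
    rw [e]
    refine (norm_add_le _ _).trans (add_le_add ?_ ?_)
    · rw [norm_mul, mul_comm]
      have := (hb l).2
      gcongr
    · rw [norm_div, hHx, div_mul_eq_mul_div]
      refine div_le_div₀ (by positivity) ?_ hC (hb l).1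
      refine (norm_sub_le _ _).trans ?_
      rw [norm_mul, add_mul]
      refine add_le_add (hQE l 5) ?_
      have h3 : ‖σ (l + 1) 2‖ ≤ ω * K₁ * (ω ^ l + V * δ ^ l) :=
        (hr' (l + 1) hl).trans (by
          calc _ ≤ K₁ * (ω * (ω ^ l + V * δ ^ l)) := by gcongr; exact hEs l
            _ = _ := by ring)
      calc _ ≤ 2 * (ω * K₁ * (ω ^ l + V * δ ^ l)) := by gcongr; exact hc l
        _ = _ := by ring
  -- the coefficient of index `1`
  have hq : ∀ l ≤ L, ‖σ l 1‖ ≤ K₂ * (ω ^ l + V * δ ^ l) := by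
    refine le_of_affine_recursion hD.le hDδ hδω hHq0 hV ?_ (hσ0 1 (by decide)) ?_
    · rw [hK₂]
      gcongr
      linarith
    intro l hl
    have e : σ (l + 1) 1 = σ l 1 * b l + (2 * σ l 2 * (b l * c l) + Q l 1) / a l := by
      rw [hrec l hl 1 (by decide)]
      simp only [quadPull, Matrix.cons_val]
      have := norm_pos_iff.1 (ha0 l)
      field_simp
      ring
    rw [e]
    refine (norm_add_le _ _).trans (add_le_add ?_ ?_)
    · rw [norm_mul, mul_comm]
      have := (hb l).2
      gcongr
    · rw [norm_div, hHq, div_mul_eq_mul_div]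
      refine div_le_div₀ (by positivity) ?_ hC (ha l).1
      refine (norm_add_le _ _).trans ?_
      rw [add_mul]
      refine add_le_add ?_ (hQE l 1)
      simp only [norm_mul, Complex.norm_two]
      calc _ ≤ 2 * (K₁ * (ω ^ l + V * δ ^ l)) * (1 * 2) := by
            have h3 := hr' l hl.le
            have h4 := hb1 l
            have h5 := hc l
            gcongr
        _ = _ := by ring
  -- the coefficient of index `4`
  have ht : ∀ l ≤ L, ‖σ l 4‖ ≤ K₃ * (ω ^ l + V * δ ^ l) := by
    refine le_of_affine_recursion hD.le hDδ hδω hHt0 hV ?_ (hσ0 4 (by decide)) ?_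
    · rw [hK₃]
      gcongr
      linarith
    intro l hl
    have e : σ (l + 1) 4 = σ l 4 * a l +
        (2 * σ l 5 * (b l * c l) + Q l 4 - c l * σ (l + 1) 1) / b l := by
      rw [hrec l hl 4 (by decide), hrec l hl 1 (by decide)]
      simp only [quadPull, Matrix.cons_val]
      have := norm_pos_iff.1 (hb0 l)
      field_simp
      ring
    rw [e]
    refine (norm_add_le _ _).trans (add_le_add ?_ ?_)
    · rw [norm_mul, mul_comm]
      have := (ha l).2
      gcongr
    · rw [norm_div, hHt, div_mul_eq_mul_div]
      refine div_le_div₀ (by positivity) ?_ hC (hb l).1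
      refine (norm_sub_le _ _).trans ((add_le_add_left (norm_add_le _ _) _).trans ?_)
      rw [add_mul, add_mul]
      refine add_le_add (add_le_add ?_ (hQE l 4)) ?_
      · simp only [norm_mul, Complex.norm_two]
        calc _ ≤ 2 * (K₂ * (ω ^ l + V * δ ^ l)) * (1 * 2) := by
              have h3 := hx l hl.le
              have h4 := hb1 l
              have h5 := hc l
              gcongr
          _ = _ := by ring
      · have h3 : ‖σ (l + 1) 1‖ ≤ ω * K₂ * (ω ^ l + V * δ ^ l) :=
          (hq (l + 1) hl).trans (by
            calc _ ≤ K₂ * (ω * (ω ^ l + V * δ ^ l)) := by gcongr; exact hEs l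
              _ = _ := by ring)
        rw [norm_mul]
        calc _ ≤ 2 * (ω * K₂ * (ω ^ l + V * δ ^ l)) := by gcongr; exact hc l
          _ = _ := by ring
  -- the coefficient of index `0`
  have hp : ∀ l ≤ L, ‖σ l 0‖ ≤ K₃ * (ω ^ l + V * δ ^ l) := by
    refine le_of_affine_recursion hD.le hDδ hδω hHp0 hV ?_ (hσ0 0 (by decide)) ?_
    · rw [hK₃]
      gcongr
      linarith
    intro l hl
    have e : σ (l + 1) 0 = σ l 0 * a l + (σ l 1 * (a l * c l) + σ l 2 * c l ^ 2 + Q l 0) / a l := by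
      rw [hrec l hl 0 (by decide)]
      simp only [quadPull, Matrix.cons_val]
      have := norm_pos_iff.1 (ha0 l)
      field_simp
      ring
    rw [e]
    refine (norm_add_le _ _).trans (add_le_add ?_ ?_)
    · rw [norm_mul, mul_comm]
      have := (ha l).2
      gcongr
    · rw [norm_div, hHp, div_mul_eq_mul_div]
      refine div_le_div₀ (by positivity) ?_ hC (ha l).1
      refine norm_add₃_le.trans ?_
      rw [add_mul, add_mul]
      have h3 := hq l hl.le
      have h4 := hr' l hl.le
      have h5 := hc l
      have h6 := ha1 l
      refine add_le_add (add_le_add ?_ ?_) (hQE l 0)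
      · simp only [norm_mul]
        calc _ ≤ K₂ * (ω ^ l + V * δ ^ l) * (1 * 2) := by gcongr
          _ = _ := by ring
      · simp only [norm_mul, norm_pow]
        calc _ ≤ K₁ * (ω ^ l + V * δ ^ l) * 2 ^ 2 := by gcongr
          _ = _ := by ring
  intro l hl i hi
  have hE0 : 0 ≤ ω ^ l + V * δ ^ l := zero_le_one.trans (hE1 l)
  have up : ∀ {z K : ℝ}, z ≤ K * (ω ^ l + V * δ ^ l) → K ≤ K₁ + K₂ + K₃ →
      z ≤ (K₁ + K₂ + K₃) * (ω ^ l + V * δ ^ l) := fun h h' => h.trans (by gcongr)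
  fin_cases i
  · exact up (hp l hl) (by linarith)
  · exact up (hq l hl) (by linarith)
  · exact up (hr' l hl) (by linarith)
  · exact absurd rfl hi
  · exact up (ht l hl) (by linarith)
  · exact up (hx l hl) (by linarith)

/-- The starting point of the `j`-th train; the `j`-th train has length `N * 2 ^ j`. -/
def trainStart (N j : ℕ) : ℕ := N * (2 ^ j - 1)

theorem trainStart_add (N j : ℕ) : trainStart N j + N = N * 2 ^ j := by
  have : 1 ≤ 2 ^ j := Nat.one_le_two_pow
  rw [trainStart, ← Nat.mul_succ, Nat.succ_eq_add_one, Nat.sub_add_cancel this]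

theorem trainStart_succ (N j : ℕ) : trainStart N (j + 1) = trainStart N j + N * 2 ^ j := by
  have h1 := trainStart_add N j
  have h2 := trainStart_add N (j + 1)
  rw [pow_succ] at h2
  linarith

@[simp] theorem trainStart_zero (N : ℕ) : trainStart N 0 = 0 := by simp [trainStart]

theorem trainStart_strictMono {N : ℕ} (hN : 0 < N) : StrictMono (trainStart N) :=
  strictMono_nat_of_lt_succ fun j => by
    rw [trainStart_succ]
    exact Nat.lt_add_of_pos_right (by positivity)

def IsTrainStart (N n : ℕ) : Prop := ∃ j, n = trainStart N j

theorem not_isTrainStart {N j n : ℕ} (hN : 0 < N) (h1 : trainStart N j < n)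
    (h2 : n < trainStart N (j + 1)) : ¬ IsTrainStart N n := by
  rintro ⟨i, rfl⟩
  have := (trainStart_strictMono hN).lt_iff_lt.1 h1
  have := (trainStart_strictMono hN).lt_iff_lt.1 h2
  omega

theorem exists_mem_train {N : ℕ} (hN : 0 < N) (n : ℕ) :
    ∃ j, trainStart N j ≤ n ∧ n < trainStart N (j + 1) := by
  have hex : ∃ j, n < trainStart N j :=
    ⟨n + 1, (Nat.lt_succ_self n).trans_le (trainStart_strictMono hN).le_apply⟩
  classical
  obtain ⟨j, hj⟩ : ∃ j, Nat.find hex = j + 1 := Nat.exists_eq_succ_of_ne_zero fun h => by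
    have := Nat.find_spec hex
    rw [h, trainStart_zero] at this
    omega
  refine ⟨j, not_lt.1 (Nat.find_min hex (by omega)), ?_⟩
  rw [← hj]
  exact Nat.find_spec hex

section Normalize

open Classical in
/-- At the start of a train, pass to the coefficients with respect to the frame used by the
preceding train. -/
def incoming (N : ℕ) (κ τ : ℕ → ℂ) (n : ℕ) (σ : Fin 6 → ℂ) : Fin 6 → ℂ :=
  if IsTrainStart N n then quadFrame (κ n) (τ n) σ else σ

open Classical in
/-- The value to which the coefficient of index `3` is set. -/
def normalCoeff (N : ℕ) (κ τ : ℕ → ℂ) (n : ℕ) (σ : Fin 6 → ℂ) : ℂ :=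
  if IsTrainStart N n then quadKill (κ n) (τ n) σ else 0

/-- One backward step of the coefficient recursion. -/
def backStep (N : ℕ) (a b c κ τ : ℕ → ℂ) (Q : ℕ → Fin 6 → ℂ) (n : ℕ) (σ : Fin 6 → ℂ) :
    Fin 6 → ℂ :=
  Function.update (quadPull (a n) (b n) (c n) (Q n) (incoming N κ τ (n + 1) σ)) 3
    (normalCoeff N κ τ n (quadPull (a n) (b n) (c n) (Q n) (incoming N κ τ (n + 1) σ)))

variable {N : ℕ} {a b c κ τ : ℕ → ℂ} {Q : ℕ → Fin 6 → ℂ}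

theorem continuous_quadPull (a b c : ℂ) (Q : Fin 6 → ℂ) : Continuous (quadPull a b c Q) := by
  refine continuous_pi fun i => ?_
  fin_cases i <;> simp [quadPull] <;> fun_prop

theorem continuous_quadFrame (κ τ : ℂ) : Continuous (quadFrame κ τ) := by
  refine continuous_pi fun i => ?_
  fin_cases i <;> simp [quadFrame] <;> fun_prop

theorem continuous_incoming (n : ℕ) : Continuous (incoming N κ τ n) := by
  unfold incoming
  split_ifs
  · exact continuous_quadFrame _ _
  · exact continuous_id

theorem continuous_normalCoeff (n : ℕ) : Continuous (normalCoeff N κ τ n) := by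
  unfold normalCoeff
  split_ifs
  · unfold quadKill
    fun_prop
  · exact continuous_const

theorem continuous_backStep (n : ℕ) : Continuous (backStep N a b c κ τ Q n) := by
  have h := (continuous_quadPull (a n) (b n) (c n) (Q n)).comp
    (continuous_incoming (N := N) (κ := κ) (τ := τ) (n + 1))
  exact h.update 3 ((continuous_normalCoeff n).comp h)

theorem quadKill_update (κ τ : ℂ) (σ : Fin 6 → ℂ) (z : ℂ) :
    quadKill κ τ (Function.update σ 3 z) = quadKill κ τ σ := by
  simp [quadKill, Function.update]

theorem normalCoeff_update (n : ℕ) (σ : Fin 6 → ℂ) (z : ℂ) :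
    normalCoeff N κ τ n (Function.update σ 3 z) = normalCoeff N κ τ n σ := by
  simp [normalCoeff, quadKill_update]

theorem backStep_three (n : ℕ) (σ : Fin 6 → ℂ) :
    backStep N a b c κ τ Q n σ 3 = normalCoeff N κ τ n (backStep N a b c κ τ Q n σ) := by
  rw [backStep, normalCoeff_update, Function.update_self]

theorem backStep_of_ne (n : ℕ) (σ : Fin 6 → ℂ) {i : Fin 6} (hi : i ≠ 3) :
    backStep N a b c κ τ Q n σ i =
      quadPull (a n) (b n) (c n) (Q n) (incoming N κ τ (n + 1) σ) i :=
  Function.update_of_ne hi _ _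

theorem quadFrame_backStep {n : ℕ} (hn : IsTrainStart N n) (hκ : κ n ≠ 0) (σ : Fin 6 → ℂ) :
    quadFrame (κ n) (τ n) (backStep N a b c κ τ Q n σ) 2 = 0 := by
  rw [backStep, normalCoeff, if_pos hn]
  exact quadFrame_update_quadKill hκ _ _

theorem norm_normalCoeff_le {n : ℕ} (hκ : 1 / 2 ≤ ‖κ n‖) (hκ1 : ‖κ n‖ ≤ 1) (hτ : ‖τ n‖ ≤ 2)
    {σ : Fin 6 → ℂ} {M : ℝ} (hσ : ∀ i, i ≠ 3 → ‖σ i‖ ≤ M) :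
    ‖normalCoeff N κ τ n σ‖ ≤ 400 * M := by
  have hM : 0 ≤ M := (norm_nonneg _).trans (hσ 0 (by decide))
  unfold normalCoeff
  split_ifs
  · exact norm_quadKill_le hκ hκ1 hτ hσ
  · simpa using hM

theorem norm_incoming_le {n : ℕ} (hκ : 1 / 2 ≤ ‖κ n‖) (hκ1 : ‖κ n‖ ≤ 1) (hτ : ‖τ n‖ ≤ 2)
    {σ : Fin 6 → ℂ} {M : ℝ} (hσ : ∀ i, ‖σ i‖ ≤ M) (i : Fin 6) :
    ‖incoming N κ τ n σ i‖ ≤ 100 * M := by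
  have hM : 0 ≤ M := (norm_nonneg _).trans (hσ 0)
  unfold incoming
  split_ifs
  · exact norm_quadFrame_le hκ hκ1 hτ hσ i
  · exact (hσ i).trans (by linarith)

end Normalize

/-- The data of the coefficient recursion are bounded. -/
structure CoeffBounds (C D K₀ : ℝ) (a b c κ τ : ℕ → ℂ) (Q : ℕ → Fin 6 → ℂ) : Prop where
  a_bound : ∀ n, C ≤ ‖a n‖ ∧ ‖a n‖ ≤ D
  b_bound : ∀ n, C ≤ ‖b n‖ ∧ ‖b n‖ ≤ D
  c_bound : ∀ n, ‖c n‖ ≤ 2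
  κ_bound : ∀ n, 1 / 2 ≤ ‖κ n‖ ∧ ‖κ n‖ ≤ 1
  τ_bound : ∀ n, ‖τ n‖ ≤ 2
  Q_bound : ∀ n i, ‖Q n i‖ ≤ K₀

theorem CoeffBounds.κ_ne_zero {C D K₀ : ℝ} {a b c κ τ : ℕ → ℂ} {Q : ℕ → Fin 6 → ℂ}
    (H : CoeffBounds C D K₀ a b c κ τ Q) (n : ℕ) : κ n ≠ 0 :=
  norm_pos_iff.1 (by linarith [(H.κ_bound n).1])

theorem exists_train_bound {C D δ ω K₀ : ℝ} (hC : 0 < C) (hCD : C ≤ D) (hDδ : D < δ)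
    (hδ : δ ≤ 1) (hω : 1 < ω) (hω' : D ^ 2 / C < ω) (hK₀ : 0 ≤ K₀) :
    ∃ K, 1 ≤ K ∧ ∀ (N : ℕ) (a b c κ τ : ℕ → ℂ) (Q : ℕ → Fin 6 → ℂ), 0 < N →
      CoeffBounds C D K₀ a b c κ τ Q → ∀ (j : ℕ) (U : ℝ) (σ : ℕ → Fin 6 → ℂ),
      (∀ i, ‖σ (trainStart N (j + 1)) i‖ ≤ U) →
      quadFrame (κ (trainStart N (j + 1))) (τ (trainStart N (j + 1)))
        (σ (trainStart N (j + 1))) 2 = 0 →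
      (∀ n, trainStart N j ≤ n → n < trainStart N (j + 1) →
        σ n = backStep N a b c κ τ Q n (σ (n + 1))) →
      ∀ n l, trainStart N j ≤ n → 0 < l → n + l = trainStart N (j + 1) →
        ∀ i, ‖σ n i‖ ≤ K * (ω ^ l + 100 * U * δ ^ l) := by
  obtain ⟨K, hK, h⟩ := exists_quadPull_stretch_bound hC hCD hDδ hδ hω hω' hK₀
  refine ⟨400 * K, by linarith, ?_⟩
  intro N a b c κ τ Q hN H j U σ hU h2 hrec
  have hU0 : 0 ≤ U := (norm_nonneg _).trans (hU 0)
  set e := trainStart N (j + 1) with he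
  set s := trainStart N j with hs
  have hse : s < e := trainStart_strictMono hN (Nat.lt_succ_self j)
  have main := h (100 * U) (e - s) (fun l => a (e - l - 1)) (fun l => b (e - l - 1))
    (fun l => c (e - l - 1)) (fun l => Q (e - l - 1))
    (fun l => if l = 0 then quadFrame (κ e) (τ e) (σ e) else σ (e - l)) (by positivity)
    (fun l => H.a_bound _) (fun l => H.b_bound _) (fun l => H.c_bound _)
    (fun l i => H.Q_bound _ i) (by simpa using h2)
    (fun i _ => by
      simpa using norm_quadFrame_le (H.κ_bound e).1 (H.κ_bound e).2 (H.τ_bound e) hU i)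
    (by
      intro l hl i hi
      have h3 := hrec (e - (l + 1)) (by omega) (by omega)
      simp only [Nat.add_eq_zero_iff, one_ne_zero, and_false, if_false]
      rw [h3, backStep_of_ne _ _ hi, Nat.sub_sub, show e - (l + 1) + 1 = e - l by omega]
      congr 2
      unfold incoming
      by_cases hl0 : l = 0
      · subst hl0
        rw [if_pos ⟨j + 1, rfl⟩, if_pos rfl]
        rfl
      · rw [if_neg hl0, if_neg (not_isTrainStart hN (j := j) (by omega) (by omega))])
  intro n l hn hl hnl i
  have hE : 0 ≤ ω ^ l + 100 * U * δ ^ l := by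
    have : 0 < δ := (hC.trans_le hCD).trans hDδ
    positivity
  have hmain : ∀ i, i ≠ 3 → ‖σ n i‖ ≤ K * (ω ^ l + 100 * U * δ ^ l) := by
    intro i hi
    have h3 := main l (by omega) i hi
    simp only [hl.ne', if_false] at h3
    rwa [show e - l = n by omega] at h3
  by_cases hi : i = 3
  · subst hi
    have h3 : σ n 3 = normalCoeff N κ τ n (σ n) := by
      rw [hrec n hn (by omega)]
      exact backStep_three _ _
    rw [h3, mul_assoc]
    exact norm_normalCoeff_le (H.κ_bound n).1 (H.κ_bound n).2 (H.τ_bound n) hmain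
  · refine (hmain i hi).trans ?_
    gcongr
    linarith

/-- The backward recursion for the coefficients has an orbit growing at most like `ω ^ n`. -/
theorem exists_coeff {C D δ ω K₀ : ℝ} (hC : 0 < C) (hCD : C ≤ D) (hDδ : D < δ)
    (hδ : δ ≤ 1) (hω : 1 < ω) (hω' : D ^ 2 / C < ω) (hωδ : ω * δ < 1) (hK₀ : 0 ≤ K₀) :
    ∃ N, 0 < N ∧ ∃ K, 0 ≤ K ∧ ∀ (a b c κ τ : ℕ → ℂ) (Q : ℕ → Fin 6 → ℂ),
      CoeffBounds C D K₀ a b c κ τ Q → ∃ σ : ℕ → Fin 6 → ℂ,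
        (∀ n i, ‖σ n i‖ ≤ K * ω ^ n) ∧ ∀ n, σ n = backStep N a b c κ τ Q n (σ (n + 1)) := by
  obtain ⟨K, hK, htrain⟩ := exists_train_bound hC hCD hDδ hδ hω hω' hK₀
  have hδ0 : 0 < δ := (hC.trans_le hCD).trans hDδ
  have hω0 : 0 < ω := one_pos.trans hω
  have hωδ0 : 0 < ω * δ := by positivity
  obtain ⟨N, hN, hN0⟩ : ∃ N : ℕ, 200 * K * (ω * δ) ^ N < 1 ∧ 0 < N := by
    have h1 : Tendsto (fun N : ℕ => 200 * K * (ω * δ) ^ N) atTop (𝓝 0) := by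
      simpa using (tendsto_pow_atTop_nhds_zero_of_lt_one hωδ0.le hωδ).const_mul (200 * K)
    exact ((h1.eventually_lt_const one_pos).and (eventually_gt_atTop 0)).exists
  set K' := K * (1 + 200 * K) * ω ^ N with hK'
  have hK'0 : 0 ≤ K' := by positivity
  have hmono := trainStart_strictMono hN0
  refine ⟨N, hN0, K', hK'0, ?_⟩
  intro a b c κ τ Q H
  set F := backStep N a b c κ τ Q with hF
  set U : ℕ → ℝ := fun j => 2 * K * ω ^ (N * 2 ^ j) with hU
  have hU0 : ∀ j, 0 ≤ U j := fun j => by positivity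
  have hUs : ∀ j l, l ≤ N * 2 ^ j →
      100 * U (j + 1) * δ ^ l = 200 * K * (ω * δ) ^ l * ω ^ (N * 2 ^ j + (N * 2 ^ j - l)) := by
    intro j l hl
    have : N * 2 ^ (j + 1) = l + (N * 2 ^ j + (N * 2 ^ j - l)) := by
      rw [pow_succ, ← mul_assoc]
      omega
    simp only [hU]
    rw [this, pow_add, mul_pow]
    ring
  -- bounds for finite horizons
  have hfin : ∀ (J : ℕ) (σ : ℕ → Fin 6 → ℂ), (∀ n, trainStart N J ≤ n → σ n = 0) →
      (∀ n < trainStart N J, σ n = F n (σ (n + 1))) → ∀ n i, ‖σ n i‖ ≤ K' * ω ^ n := by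
    intro J σ hσ0 hσ
    have hvan : ∀ j, quadFrame (κ (trainStart N j)) (τ (trainStart N j))
        (σ (trainStart N j)) 2 = 0 := by
      intro j
      rcases lt_or_ge j J with hj | hj
      · rw [hσ _ (hmono hj)]
        exact quadFrame_backStep ⟨j, rfl⟩ (H.κ_ne_zero _) _
      · rw [hσ0 _ (hmono.monotone hj)]
        simp [quadFrame]
    have hstart : ∀ k j, j + k = J → ∀ i, ‖σ (trainStart N j) i‖ ≤ U j := by
      intro k
      induction k with
      | zero =>
        intro j hj i
        rw [hσ0 _ (hmono.monotone (by omega))]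
        simpa using hU0 j
      | succ k ih =>
        intro j hj i
        have h1 := htrain N a b c κ τ Q hN0 H j (U (j + 1)) σ (ih (j + 1) (by omega))
          (hvan (j + 1)) (fun n _ h2 => hσ n (h2.trans_le (hmono.monotone (by omega))))
          (trainStart N j) (N * 2 ^ j) le_rfl (by positivity) (trainStart_succ N j).symm i
        refine h1.trans ?_
        have h2 : (ω * δ) ^ (N * 2 ^ j) ≤ (ω * δ) ^ N :=
          pow_le_pow_of_le_one hωδ0.le hωδ.le (Nat.le_mul_of_pos_right _ (by positivity))
        rw [hUs j _ le_rfl, Nat.sub_self, add_zero]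
        have h3 : 200 * K * (ω * δ) ^ (N * 2 ^ j) ≤ 1 := by
          refine le_trans ?_ hN.le
          gcongr
        calc _ ≤ K * (ω ^ (N * 2 ^ j) + 1 * ω ^ (N * 2 ^ j)) := by gcongr
          _ = U j := by ring
    intro n i
    obtain ⟨j, hj1, hj2⟩ := exists_mem_train hN0 n
    rcases lt_or_ge j J with hj | hj
    · obtain ⟨l, hl⟩ := Nat.exists_eq_add_of_le hj2.le
      have h1 := htrain N a b c κ τ Q hN0 H j (U (j + 1)) σ
        (hstart (J - (j + 1)) (j + 1) (by omega))
        (hvan (j + 1)) (fun n _ h2 => hσ n (h2.trans_le (hmono.monotone (by omega))))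
        n l hj1 (by omega) hl.symm i
      refine h1.trans ?_
      have e1 := trainStart_succ N j
      have e2 := trainStart_add N j
      have hlN : l ≤ N * 2 ^ j := by omega
      rw [hUs j l hlN, show N * 2 ^ j + (N * 2 ^ j - l) = N + n by omega]
      have h2 : (ω * δ) ^ l ≤ 1 := pow_le_one₀ hωδ0.le hωδ.le
      have h3 : ω ^ l ≤ ω ^ (N + n) := pow_le_pow_right₀ hω.le (by omega)
      calc _ ≤ K * (ω ^ (N + n) + 200 * K * 1 * ω ^ (N + n)) := by gcongr
        _ = K' * ω ^ n := by
          rw [hK', pow_add]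
          ring
    · rw [hσ0 n ((hmono.monotone hj).trans hj1)]
      simpa using by positivity
  -- existence for finite horizons
  have hex : ∀ m, ∃ σ : ℕ → Fin 6 → ℂ, (∀ n, m ≤ n → σ n = 0) ∧
      ∀ n < m, σ n = F n (σ (n + 1)) := by
    intro m
    let back : ℕ → Fin 6 → ℂ := fun k => Nat.rec 0 (fun k ρ => F (m - (k + 1)) ρ) k
    refine ⟨fun n => back (m - n), fun n hn => ?_, fun n hn => ?_⟩
    · change back (m - n) = 0
      rw [Nat.sub_eq_zero_of_le hn]
      rfl
    · obtain ⟨k, hk⟩ := Nat.exists_eq_add_of_lt hn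
      have e1 : m - n = k + 1 := by omega
      have e2 : m - (n + 1) = k := by omega
      have e3 : n = m - (k + 1) := by omega
      change back (m - n) = F n (back (m - (n + 1)))
      rw [e1, e2]
      conv_rhs => rw [e3]
  -- passage to the limit by compactness
  let t : ℕ → Set (ℕ → Fin 6 → ℂ) := fun J =>
    (Set.pi univ fun n => closedBall 0 (K' * ω ^ n)) ∩
      ⋂ n, ⋂ (_ : n < trainStart N J), {σ | σ n = F n (σ (n + 1))}
  have hbox : IsCompact (Set.pi univ fun n => closedBall (0 : Fin 6 → ℂ) (K' * ω ^ n)) :=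
    isCompact_univ_pi fun n => isCompact_closedBall _ _
  have hclosed : ∀ J, IsClosed (t J) := fun J => hbox.isClosed.inter <|
    isClosed_iInter fun n => isClosed_iInter fun _ =>
      isClosed_eq (continuous_apply n) ((continuous_backStep n).comp (continuous_apply (n + 1)))
  obtain ⟨σ, hσ⟩ := IsCompact.nonempty_iInter_of_sequence_nonempty_isCompact_isClosed t
    (fun J => inter_subset_inter_right _ (iInter_mono fun n => iInter_mono' fun hn =>
      ⟨hn.trans (hmono (Nat.lt_succ_self J)), le_rfl⟩))
    (fun J => by
      obtain ⟨σ, h1, h2⟩ := hex (trainStart N J)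
      refine ⟨σ, fun n _ => ?_, ?_⟩
      · rw [mem_closedBall_zero_iff, pi_norm_le_iff_of_nonneg (by positivity)]
        exact hfin J σ h1 h2 n
      · simpa using h2)
    (hbox.inter_right (isClosed_iInter fun n => isClosed_iInter fun _ =>
      isClosed_eq (continuous_apply n) ((continuous_backStep n).comp (continuous_apply (n + 1)))))
    hclosed
  rw [mem_iInter] at hσ
  refine ⟨σ, fun n => ?_, fun n => ?_⟩
  · have := (hσ 0).1 n trivial
    rwa [mem_closedBall_zero_iff, pi_norm_le_iff_of_nonneg (by positivity)] at this
  · have := (hσ (n + 1)).2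
    simp only [mem_iInter] at this
    exact this n ((Nat.lt_succ_self n).trans_le hmono.le_apply)

/-- Coordinates `x = lam x • u + mu x • v` on `ℂ²` with controlled sizes. -/
structure IsFrame (u v : ℂ × ℂ) (lam mu : ℂ × ℂ →L[ℂ] ℂ) : Prop where
  norm_u : ‖u‖ = 1
  norm_v : ‖v‖ = 1
  norm_lam : ∀ x, ‖lam x‖ ≤ ‖x‖
  norm_mu : ∀ x, ‖mu x‖ ≤ 2 * ‖x‖
  lam_u : lam u = 1
  lam_v : lam v = 0
  mu_u : mu u = 0
  mu_v : mu v = 1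
  expand : ∀ x, x = lam x • u + mu x • v

theorem exists_unimodular_mul_eq_norm (z : ℂ) : ∃ w : ℂ, ‖w‖ = 1 ∧ z * w = ‖z‖ := by
  by_cases hz : z = 0
  · exact ⟨1, by simp, by simp [hz]⟩
  · have hz' : (‖z‖ : ℂ) ≠ 0 := by simpa using hz
    refine ⟨‖z‖ / z, ?_, ?_⟩
    · rw [norm_div, Complex.norm_real, norm_norm, div_self (by simpa using hz)]
    · field_simp

theorem exists_isFrame {v : ℂ × ℂ} (hv : ‖v‖ = 1) : ∃ u lam mu, IsFrame u v lam mu := by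
  obtain ⟨w₁, hw₁, h1⟩ := exists_unimodular_mul_eq_norm v.1
  obtain ⟨w₂, hw₂, h2⟩ := exists_unimodular_mul_eq_norm v.2
  have hv1 : ‖v.1‖ ≤ 1 := hv ▸ norm_fst_le v
  have hv2 : ‖v.2‖ ≤ 1 := hv ▸ norm_snd_le v
  set S : ℝ := ‖v.1‖ + ‖v.2‖ with hS
  have hS1 : 1 ≤ S := by
    rw [← hv, Prod.norm_def]
    exact max_le (le_add_of_nonneg_right (norm_nonneg _)) (le_add_of_nonneg_left (norm_nonneg _))
  have hS0 : 0 < S := one_pos.trans_le hS1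
  have hSc : (S : ℂ) ≠ 0 := by exact_mod_cast hS0.ne'
  have hSe : (S : ℂ) = v.1 * w₁ + v.2 * w₂ := by rw [h1, h2, hS]; push_cast; rfl
  let p1 := ContinuousLinearMap.fst ℂ ℂ ℂ
  let p2 := ContinuousLinearMap.snd ℂ ℂ ℂ
  refine ⟨(-w₂, w₁), (S : ℂ)⁻¹ • (v.1 • p2 - v.2 • p1), (S : ℂ)⁻¹ • (w₁ • p1 + w₂ • p2), ?_⟩
  have hx1 : ∀ x : ℂ × ℂ, ‖x.1‖ ≤ ‖x‖ := norm_fst_le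
  have hx2 : ∀ x : ℂ × ℂ, ‖x.2‖ ≤ ‖x‖ := norm_snd_le
  have hSn : ‖(S : ℂ)‖ = S := by rw [Complex.norm_real, Real.norm_of_nonneg hS0.le]
  refine ⟨?_, hv, fun x => ?_, fun x => ?_, ?_, ?_, ?_, ?_, fun x => ?_⟩
  · simp [Prod.norm_def, hw₁, hw₂]
  · simp only [p1, p2, smul_apply, sub_apply,
      ContinuousLinearMap.coe_fst', ContinuousLinearMap.coe_snd', smul_eq_mul]
    rw [norm_mul, norm_inv, hSn, inv_mul_le_iff₀ hS0]
    refine (norm_sub_le _ _).trans ?_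
    rw [norm_mul, norm_mul, hS, add_mul]
    gcongr
    · exact hx2 x
    · exact hx1 x
  · simp only [p1, p2, smul_apply, add_apply,
      ContinuousLinearMap.coe_fst', ContinuousLinearMap.coe_snd', smul_eq_mul]
    rw [norm_mul, norm_inv, hSn, inv_mul_le_iff₀ hS0]
    refine (norm_add_le _ _).trans ?_
    rw [norm_mul, norm_mul, hw₁, hw₂]
    nlinarith [hx1 x, hx2 x, norm_nonneg x]
  · simp [p1, p2]
    field_simp
    rw [hSe]
  · simp [p1, p2]
    ring_nf
    simp
  · simp [p1, p2]
    ring_nf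
  · simp [p1, p2]
    field_simp
    rw [hSe]
    ring
  · ext
    · simp [p1, p2]
      field_simp
      rw [hSe]
      ring
    · simp [p1, p2]
      field_simp
      rw [hSe]
      ring

namespace IsFrame

variable {u v : ℂ × ℂ} {lam mu : ℂ × ℂ →L[ℂ] ℂ}

theorem lam_comb (h : IsFrame u v lam mu) (s t : ℂ) : lam (s • u + t • v) = s := by
  simp [h.lam_u, h.lam_v]

theorem mu_comb (h : IsFrame u v lam mu) (s t : ℂ) : mu (s • u + t • v) = t := by
  simp [h.mu_u, h.mu_v]

theorem norm_comb_le (h : IsFrame u v lam mu) (s t : ℂ) : ‖s • u + t • v‖ ≤ ‖s‖ + ‖t‖ := by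
  refine (norm_add_le _ _).trans_eq ?_
  rw [norm_smul, norm_smul, h.norm_u, h.norm_v, mul_one, mul_one]

end IsFrame

/-- The quadratic map of `ℂ²` with given coefficients in the frame. -/
def frameQuad (u v : ℂ × ℂ) (lam mu : ℂ × ℂ →L[ℂ] ℂ) (σ : Fin 6 → ℂ) (x : ℂ × ℂ) : ℂ × ℂ :=
  (quadEval σ (lam x) (mu x)).1 • u + (quadEval σ (lam x) (mu x)).2 • v

section Transfer

variable {u v u' v' : ℂ × ℂ} {lam mu lam' mu' : ℂ × ℂ →L[ℂ] ℂ}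

/-- Coefficients of a continuous bilinear map with respect to two frames. -/
def bilinCoeff (u v : ℂ × ℂ) (lam' mu' : ℂ × ℂ →L[ℂ] ℂ)
    (Q : ℂ × ℂ →L[ℂ] ℂ × ℂ →L[ℂ] ℂ × ℂ) : Fin 6 → ℂ :=
  ![lam' (Q u u), lam' (Q u v + Q v u), lam' (Q v v),
    mu' (Q u u), mu' (Q u v + Q v u), mu' (Q v v)]

theorem norm_bilinCoeff_le (h : IsFrame u v lam mu) (h' : IsFrame u' v' lam' mu')
    {Q : ℂ × ℂ →L[ℂ] ℂ × ℂ →L[ℂ] ℂ × ℂ} {K : ℝ} (hQ : ‖Q‖ ≤ K) (i : Fin 6) :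
    ‖bilinCoeff u v lam' mu' Q i‖ ≤ 4 * K := by
  have hK : 0 ≤ K := (norm_nonneg Q).trans hQ
  have hb : ∀ {x y : ℂ × ℂ}, ‖x‖ = 1 → ‖y‖ = 1 → ‖Q x y‖ ≤ K := fun {x y} hx hy => by
    have := Q.le_opNorm₂ x y
    rw [hx, hy, mul_one, mul_one] at this
    exact this.trans hQ
  have huu := hb h.norm_u h.norm_u
  have hvv := hb h.norm_v h.norm_v
  have huv : ‖Q u v + Q v u‖ ≤ 2 * K := by
    refine (norm_add_le _ _).trans ?_
    linarith [hb h.norm_u h.norm_v, hb h.norm_v h.norm_u]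
  fin_cases i
  · exact (h'.norm_lam _).trans (huu.trans (by linarith))
  · exact (h'.norm_lam _).trans (huv.trans (by linarith))
  · exact (h'.norm_lam _).trans (hvv.trans (by linarith))
  · exact (h'.norm_mu _).trans (by linarith)
  · exact (h'.norm_mu _).trans (by linarith)
  · exact (h'.norm_mu _).trans (by linarith)

theorem bilin_eq (h : IsFrame u v lam mu) (h' : IsFrame u' v' lam' mu')
    (Q : ℂ × ℂ →L[ℂ] ℂ × ℂ →L[ℂ] ℂ × ℂ) (x : ℂ × ℂ) :
    Q x x = (quadEval (bilinCoeff u v lam' mu' Q) (lam x) (mu x)).1 • u' +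
      (quadEval (bilinCoeff u v lam' mu' Q) (lam x) (mu x)).2 • v' := by
  have e : Q x x = (lam x ^ 2) • Q u u + (lam x * mu x) • (Q u v + Q v u) +
      (mu x ^ 2) • Q v v := by
    conv_lhs => rw [h.expand x]
    simp only [map_add, map_smul, add_apply, smul_apply,
      smul_add, smul_smul]
    module
  have e1 := h'.expand (Q x x)
  rw [e1]
  congr 2
  · rw [e]
    simp only [map_add, map_smul, smul_eq_mul, quadEval, bilinCoeff, Matrix.cons_val]
    ring
  · rw [e]
    simp only [map_add, map_smul, smul_eq_mul, quadEval, bilinCoeff, Matrix.cons_val]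
    ring

theorem norm_frameQuad_le (h : IsFrame u v lam mu) {σ : Fin 6 → ℂ} {M : ℝ}
    (hσ : ∀ i, ‖σ i‖ ≤ M) (x : ℂ × ℂ) : ‖frameQuad u v lam mu σ x‖ ≤ 14 * M * ‖x‖ ^ 2 := by
  have hM : 0 ≤ M := (norm_nonneg _).trans (hσ 0)
  have key : ∀ i j k : Fin 6, ‖σ i * lam x ^ 2 + σ j * (lam x * mu x) + σ k * mu x ^ 2‖ ≤
      7 * M * ‖x‖ ^ 2 := by
    intro i j k
    refine norm_add₃_le.trans ?_
    simp only [norm_mul, norm_pow]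
    calc _ ≤ M * ‖x‖ ^ 2 + M * (‖x‖ * (2 * ‖x‖)) + M * (2 * ‖x‖) ^ 2 := by
          gcongr
          exacts [hσ i, h.norm_lam x, hσ j, h.norm_lam x, h.norm_mu x, hσ k, h.norm_mu x]
      _ = _ := by ring
  refine (h.norm_comb_le _ _).trans ((add_le_add (key 0 1 2) (key 3 4 5)).trans_eq (by ring))

theorem norm_frameQuad_add_sub_le (h : IsFrame u v lam mu) {σ : Fin 6 → ℂ} {M : ℝ}
    (hσ : ∀ i, ‖σ i‖ ≤ M) (x y : ℂ × ℂ) :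
    ‖frameQuad u v lam mu σ (x + y) - frameQuad u v lam mu σ x‖ ≤
      28 * M * (‖x‖ + ‖y‖) * ‖y‖ := by
  have hM : 0 ≤ M := (norm_nonneg _).trans (hσ 0)
  have key : ∀ i j k : Fin 6,
      ‖(σ i * lam (x + y) ^ 2 + σ j * (lam (x + y) * mu (x + y)) + σ k * mu (x + y) ^ 2) -
        (σ i * lam x ^ 2 + σ j * (lam x * mu x) + σ k * mu x ^ 2)‖ ≤
      14 * M * (‖x‖ + ‖y‖) * ‖y‖ := by
    intro i j k
    have e : (σ i * lam (x + y) ^ 2 + σ j * (lam (x + y) * mu (x + y)) + σ k * mu (x + y) ^ 2) -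
        (σ i * lam x ^ 2 + σ j * (lam x * mu x) + σ k * mu x ^ 2) =
        σ i * ((2 * lam x + lam y) * lam y) +
        σ j * (lam x * mu y + lam y * mu x + lam y * mu y) +
        σ k * ((2 * mu x + mu y) * mu y) := by
      rw [map_add, map_add]
      ring
    have l1 := h.norm_lam x
    have l2 := h.norm_lam y
    have m1 := h.norm_mu x
    have m2 := h.norm_mu y
    have n1 : ‖2 * lam x + lam y‖ ≤ 2 * ‖x‖ + ‖y‖ := by
      refine (norm_add_le _ _).trans ?_
      rw [norm_mul, Complex.norm_two]
      gcongr
    have n2 : ‖2 * mu x + mu y‖ ≤ 2 * (2 * ‖x‖) + 2 * ‖y‖ := by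
      refine (norm_add_le _ _).trans ?_
      rw [norm_mul, Complex.norm_two]
      gcongr
    have n3 : ‖lam x * mu y + lam y * mu x + lam y * mu y‖ ≤
        ‖x‖ * (2 * ‖y‖) + ‖y‖ * (2 * ‖x‖) + ‖y‖ * (2 * ‖y‖) := by
      refine norm_add₃_le.trans ?_
      simp only [norm_mul]
      gcongr
    rw [e]
    refine norm_add₃_le.trans ?_
    rw [norm_mul, norm_mul, norm_mul, norm_mul, norm_mul]
    calc _ ≤ M * ((2 * ‖x‖ + ‖y‖) * ‖y‖) + M * (‖x‖ * (2 * ‖y‖) + ‖y‖ * (2 * ‖x‖) +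
          ‖y‖ * (2 * ‖y‖)) + M * ((2 * (2 * ‖x‖) + 2 * ‖y‖) * (2 * ‖y‖)) := by
          gcongr
          exacts [hσ i, hσ j, hσ k]
      _ = M * ‖y‖ * (14 * ‖x‖ + 7 * ‖y‖) := by ring
      _ ≤ M * ‖y‖ * (14 * (‖x‖ + ‖y‖)) := by
        gcongr
        linarith [norm_nonneg y]
      _ = _ := by ring
  have e : frameQuad u v lam mu σ (x + y) - frameQuad u v lam mu σ x =
      ((quadEval σ (lam (x + y)) (mu (x + y))).1 - (quadEval σ (lam x) (mu x)).1) • u +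
      ((quadEval σ (lam (x + y)) (mu (x + y))).2 - (quadEval σ (lam x) (mu x)).2) • v := by
    simp only [frameQuad]
    module
  rw [e]
  exact (h.norm_comb_le _ _).trans ((add_le_add (key 0 1 2) (key 3 4 5)).trans_eq (by ring))

theorem analyticOnNhd_frameQuad (σ : Fin 6 → ℂ) :
    AnalyticOnNhd ℂ (frameQuad u v lam mu σ) univ := by
  intro x _
  unfold frameQuad quadEval
  have h1 : AnalyticAt ℂ (fun x => lam x) x := lam.analyticAt x
  have h2 : AnalyticAt ℂ (fun x => mu x) x := mu.analyticAt x
  fun_prop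

/-- Change to a frame whose distinguished direction is the complementary direction `u`. -/
theorem frameQuad_quadFrame (h : IsFrame u v lam mu) (h' : IsFrame u' u lam' mu')
    (σ : Fin 6 → ℂ) (x : ℂ × ℂ) :
    frameQuad u' u lam' mu' σ x =
      frameQuad u v lam mu (quadFrame (lam' v) (mu' v) σ) x := by
  have hv : v = lam' v • u' + mu' v • u := h'.expand v
  have hκ : lam' v ≠ 0 := by
    intro h0
    rw [h0, zero_smul, zero_add] at hv
    have h1 := congrArg mu hv
    rw [map_smul, h.mu_v, h.mu_u, smul_zero] at h1
    exact one_ne_zero h1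
  have e1 : lam' x = lam' v * mu x := by
    conv_lhs => rw [h.expand x]
    rw [map_add, map_smul, map_smul, h'.lam_v, smul_zero, zero_add, smul_eq_mul, mul_comm]
  have e2 : mu' x = lam x + mu' v * mu x := by
    conv_lhs => rw [h.expand x]
    rw [map_add, map_smul, map_smul, h'.mu_v, smul_eq_mul, smul_eq_mul, mul_one, mul_comm]
  have key := quadEval_quadFrame hκ (mu' v) σ (lam x) (mu x)
  rw [← e1, ← e2] at key
  rw [frameQuad, frameQuad, key]
  simp only
  generalize (quadEval (quadFrame (lam' v) (mu' v) σ) (lam x) (mu x)) = w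
  conv_rhs => rw [hv]
  simp only [smul_add, smul_smul]
  module

theorem frame_change_bounds (h : IsFrame u v lam mu) (h' : IsFrame u' u lam' mu') :
    (1 / 2 ≤ ‖lam' v‖ ∧ ‖lam' v‖ ≤ 1) ∧ ‖mu' v‖ ≤ 2 := by
  have hv : v = lam' v • u' + mu' v • u := h'.expand v
  have h1 : (1 : ℂ) = lam' v * mu u' := by
    have := congrArg mu hv
    rwa [map_add, map_smul, map_smul, h.mu_v, h.mu_u, smul_zero, add_zero, smul_eq_mul] at this
  have h2 : (1 : ℝ) = ‖lam' v‖ * ‖mu u'‖ := by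
    rw [← norm_mul, ← h1, norm_one]
  have h3 := h.norm_mu u'
  have h4 := h'.norm_lam v
  have h5 := h'.norm_mu v
  rw [h.norm_v] at h4 h5
  rw [h'.norm_u] at h3
  refine ⟨⟨?_, h4⟩, by linarith⟩
  nlinarith [norm_nonneg (lam' v)]

end Transfer

/-- Frames adapted to a sequence of linear maps `A n`: in the frame `(u n, v n)` at the source
and the frame `(u' n, v' n)` at the target, `A n` is lower triangular; the target frame is the
source frame of `A (n + 1)` inside a train, and `v (n + 1) = u' n` at the start of a train. -/
structure AdaptedFrames (N : ℕ) (C D : ℝ) (A : ℕ → ℂ × ℂ →L[ℂ] ℂ × ℂ) where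
  (u v u' v' : ℕ → ℂ × ℂ)
  (lam mu lam' mu' : ℕ → ℂ × ℂ →L[ℂ] ℂ)
  (a b c κ τ : ℕ → ℂ)
  frame : ∀ n, IsFrame (u n) (v n) (lam n) (mu n)
  frame' : ∀ n, IsFrame (u' n) (v' n) (lam' n) (mu' n)
  lam_map : ∀ n x, lam' n (A n x) = a n * lam n x
  mu_map : ∀ n x, mu' n (A n x) = c n * lam n x + b n * mu n x
  lam_eq : ∀ n, ¬ IsTrainStart N (n + 1) → lam (n + 1) = lam' n
  change : ∀ n σ x, frameQuad (u (n + 1)) (v (n + 1)) (lam (n + 1)) (mu (n + 1)) σ x =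
    frameQuad (u' n) (v' n) (lam' n) (mu' n) (incoming N κ τ (n + 1) σ) x
  a_bound : ∀ n, C ≤ ‖a n‖ ∧ ‖a n‖ ≤ D
  b_bound : ∀ n, C ≤ ‖b n‖ ∧ ‖b n‖ ≤ D
  c_bound : ∀ n, ‖c n‖ ≤ 2
  κ_bound : ∀ n, 1 / 2 ≤ ‖κ n‖ ∧ ‖κ n‖ ≤ 1
  τ_bound : ∀ n, ‖τ n‖ ≤ 2

theorem exists_inverse_of_bounded_below {A : ℂ × ℂ →L[ℂ] ℂ × ℂ} {C : ℝ}
    (hC : 0 < C) (hA : ∀ x, C * ‖x‖ ≤ ‖A x‖) :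
    ∃ B : ℂ × ℂ →L[ℂ] ℂ × ℂ, (∀ x, B (A x) = x) ∧ ∀ y, A (B y) = y := by
  have hinj : Function.Injective (A : ℂ × ℂ →ₗ[ℂ] ℂ × ℂ) := by
    rw [← LinearMap.ker_eq_bot, LinearMap.ker_eq_bot']
    intro x hx
    have h := hA x
    rw [show A x = 0 from hx, norm_zero] at h
    exact norm_le_zero_iff.1 (nonpos_of_mul_nonpos_right h hC)
  let e := LinearEquiv.ofInjectiveEndo (A : ℂ × ℂ →ₗ[ℂ] ℂ × ℂ) hinj
  exact ⟨LinearMap.toContinuousLinearMap e.symm, fun x => e.symm_apply_apply x,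
    fun y => e.apply_symm_apply y⟩

/-- Triangular form of a linear map in two frames whose distinguished directions correspond. -/
theorem IsFrame.map_triangular {u v u' v' : ℂ × ℂ} {lam mu lam' mu' : ℂ × ℂ →L[ℂ] ℂ}
    (h : IsFrame u v lam mu) (h' : IsFrame u' v' lam' mu') {A : ℂ × ℂ →L[ℂ] ℂ × ℂ} {C D : ℝ}
    (hC : 0 < C) (hA : ∀ x, C * ‖x‖ ≤ ‖A x‖ ∧ ‖A x‖ ≤ D * ‖x‖) {b : ℂ} (hv : A v = b • v') :
    (∀ x, lam' (A x) = lam' (A u) * lam x) ∧ (∀ x, mu' (A x) = mu' (A u) * lam x + b * mu x) ∧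
      (C ≤ ‖lam' (A u)‖ ∧ ‖lam' (A u)‖ ≤ D) ∧ ‖mu' (A u)‖ ≤ 2 * D := by
  have e : ∀ x, A x = lam x • A u + mu x • b • v' := fun x => by
    conv_lhs => rw [h.expand x]
    rw [map_add, map_smul, map_smul, hv]
  have e1 : ∀ x, lam' (A x) = lam' (A u) * lam x := fun x => by
    rw [e x]
    simp [h'.lam_v, mul_comm]
  have hu := (hA u).2
  rw [h.norm_u, mul_one] at hu
  refine ⟨e1, fun x => ?_, ⟨?_, (h'.norm_lam _).trans hu⟩, (h'.norm_mu _).trans (by linarith)⟩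
  · rw [e x]
    simp [h'.mu_v, mul_comm]
  · obtain ⟨B, -, hB⟩ := exists_inverse_of_bounded_below hC fun x => (hA x).1
    obtain ⟨w, hw⟩ : ∃ w, A w = u' := ⟨B u', hB u'⟩
    have h1 := e1 w
    rw [hw, h'.lam_u] at h1
    have h2 : (1 : ℝ) = ‖lam' (A u)‖ * ‖lam w‖ := by rw [← norm_mul, ← h1, norm_one]
    have h3 := (hA w).1
    rw [hw, h'.norm_u] at h3
    have h4 := h.norm_lam w
    have h5 := norm_nonneg (lam' (A u))
    calc C = C * ‖lam w‖ * ‖lam' (A u)‖ := by rw [mul_assoc, mul_comm ‖lam w‖, ← h2, mul_one]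
      _ ≤ C * ‖w‖ * ‖lam' (A u)‖ := by gcongr
      _ ≤ 1 * ‖lam' (A u)‖ := by gcongr
      _ = _ := one_mul _

open Classical in
theorem nonempty_adaptedFrames (N : ℕ) {C D : ℝ} (hC : 0 < C) (hD : D ≤ 1)
    {A : ℕ → ℂ × ℂ →L[ℂ] ℂ × ℂ} (hA : ∀ n x, C * ‖x‖ ≤ ‖A n x‖ ∧ ‖A n x‖ ≤ D * ‖x‖) :
    Nonempty (AdaptedFrames N C D A) := by
  have hex : ∀ v : ℂ × ℂ, ∃ u lam mu, ‖v‖ = 1 → IsFrame u v lam mu := fun v => by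
    by_cases hv : ‖v‖ = 1
    · obtain ⟨u, lam, mu, h⟩ := exists_isFrame hv
      exact ⟨u, lam, mu, fun _ => h⟩
    · exact ⟨0, 0, 0, fun h => absurd h hv⟩
  choose U Lam Mu hF using hex
  let nrm : ℕ → ℂ × ℂ → ℂ × ℂ := fun n w => ((‖A n w‖ : ℂ)⁻¹) • A n w
  let v : ℕ → ℂ × ℂ := fun n => Nat.rec (1, 0)
    (fun n w => if IsTrainStart N (n + 1) then U (nrm n w) else nrm n w) n
  have v_succ : ∀ n, v (n + 1) =
    if IsTrainStart N (n + 1) then U (nrm n (v n)) else nrm n (v n) := fun n => rfl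
  have hpos : ∀ n w, ‖w‖ = 1 → C ≤ ‖A n w‖ ∧ ‖A n w‖ ≤ D := fun n w hw => by
    simpa [hw] using hA n w
  have hnrm : ∀ n w, ‖w‖ = 1 → ‖nrm n w‖ = 1 := fun n w hw => by
    have : ‖A n w‖ ≠ 0 := (hC.trans_le (hpos n w hw).1).ne'
    simp only [nrm]
    rw [norm_smul, norm_inv, Complex.norm_real, norm_norm, inv_mul_cancel₀ this]
  have hv : ∀ n, ‖v n‖ = 1 := by
    intro n
    induction n with
    | zero => simp [v, Prod.norm_def]
    | succ n ih =>
      rw [v_succ]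
      split_ifs
      · exact (hF _ (hnrm n _ ih)).norm_u
      · exact hnrm n _ ih
  have hfr : ∀ n, IsFrame (U (v n)) (v n) (Lam (v n)) (Mu (v n)) := fun n => hF _ (hv n)
  have hv' : ∀ n, ‖nrm n (v n)‖ = 1 := fun n => hnrm n _ (hv n)
  have hfr' : ∀ n, IsFrame (U (nrm n (v n))) (nrm n (v n)) (Lam (nrm n (v n)))
    (Mu (nrm n (v n))) := fun n => hF _ (hv' n)
  have hAv : ∀ n, A n (v n) = (‖A n (v n)‖ : ℂ) • nrm n (v n) := fun n => by
    have : (‖A n (v n)‖ : ℂ) ≠ 0 :=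
      Complex.ofReal_ne_zero.2 (hC.trans_le (hpos n _ (hv n)).1).ne'
    simp only [nrm]
    rw [smul_smul, mul_inv_cancel₀ this, one_smul]
  have htri := fun n => (hfr n).map_triangular (hfr' n) hC (hA n) (hAv n)
  have hfr'' : ∀ n, IsTrainStart N (n + 1) →
      IsFrame (U (v (n + 1))) (U (nrm n (v n))) (Lam (v (n + 1))) (Mu (v (n + 1))) := by
    intro n hn
    have := hfr (n + 1)
    rw [v_succ, if_pos hn] at this ⊢
    exact this
  let κ : ℕ → ℂ := fun m => Nat.casesOn m 1
    fun n => if IsTrainStart N (n + 1) then Lam (v (n + 1)) (nrm n (v n)) else 1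
  let τ : ℕ → ℂ := fun m => Nat.casesOn m 0
    fun n => if IsTrainStart N (n + 1) then Mu (v (n + 1)) (nrm n (v n)) else 0
  have κ_succ : ∀ n, κ (n + 1) =
    if IsTrainStart N (n + 1) then Lam (v (n + 1)) (nrm n (v n)) else 1 := fun n => rfl
  have τ_succ : ∀ n, τ (n + 1) =
    if IsTrainStart N (n + 1) then Mu (v (n + 1)) (nrm n (v n)) else 0 := fun n => rfl
  have hC1 : C ≤ 1 := by
    have := hpos 0 (v 0) (hv 0)
    linarith
  refine ⟨⟨fun n => U (v n), v, fun n => U (nrm n (v n)), fun n => nrm n (v n),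
    fun n => Lam (v n), fun n => Mu (v n), fun n => Lam (nrm n (v n)), fun n => Mu (nrm n (v n)),
    fun n => Lam (nrm n (v n)) (A n (U (v n))), fun n => (‖A n (v n)‖ : ℂ),
    fun n => Mu (nrm n (v n)) (A n (U (v n))), κ, τ, hfr, hfr', fun n => (htri n).1,
    fun n => (htri n).2.1, fun n hn => ?_, fun n σ x => ?_, fun n => (htri n).2.2.1,
    fun n => ?_, fun n => (htri n).2.2.2.trans (by linarith), fun n => ?_, fun n => ?_⟩⟩
  · simp only [v_succ, if_neg hn]
  · by_cases hn : IsTrainStart N (n + 1)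
    · rw [incoming, if_pos hn, κ_succ, τ_succ, if_pos hn, if_pos hn,
        ← frameQuad_quadFrame (hfr' n) (hfr'' n hn)]
      simp only [v_succ, if_pos hn]
    · rw [incoming, if_neg hn, v_succ, if_neg hn]
  · rw [Complex.norm_real, norm_norm]
    exact hpos n _ (hv n)
  · cases n with
    | zero => simp [κ]; norm_num
    | succ n =>
      rw [κ_succ]
      split_ifs with hn
      · exact (frame_change_bounds (hfr' n) (hfr'' n hn)).1
      · simp; norm_num
  · cases n with
    | zero => simp [τ]
    | succ n =>
      rw [τ_succ]
      split_ifs with hn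
      · exact (frame_change_bounds (hfr' n) (hfr'' n hn)).2
      · simp

namespace AdaptedFrames

variable {N : ℕ} {C D : ℝ} {A : ℕ → ℂ × ℂ →L[ℂ] ℂ × ℂ} (F : AdaptedFrames N C D A)
  (Q : ℕ → ℂ × ℂ →L[ℂ] ℂ × ℂ →L[ℂ] ℂ × ℂ)

/-- Coefficients of the quadratic terms in the adapted frames. -/
def quadCoeff (n : ℕ) : Fin 6 → ℂ := bilinCoeff (F.u n) (F.v n) (F.lam' n) (F.mu' n) (Q n)

theorem coeffBounds {K : ℝ} (hQ : ∀ n, ‖Q n‖ ≤ K) :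
    CoeffBounds C D (4 * K) F.a F.b F.c F.κ F.τ (F.quadCoeff Q) :=
  ⟨F.a_bound, F.b_bound, F.c_bound, F.κ_bound, F.τ_bound,
    fun n => norm_bilinCoeff_le (F.frame n) (F.frame' n) (hQ n)⟩

/-- The quadratic map with coefficients `σ n` in the `n`-th frame. -/
def corr (σ : ℕ → Fin 6 → ℂ) (n : ℕ) : ℂ × ℂ → ℂ × ℂ :=
  frameQuad (F.u n) (F.v n) (F.lam n) (F.mu n) (σ n)

/-- The defect of the coefficient of index `3` in the recursion. -/
def defect (σ : ℕ → Fin 6 → ℂ) (n : ℕ) : ℂ :=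
  quadPull (F.a n) (F.b n) (F.c n) (F.quadCoeff Q n)
    (incoming N F.κ F.τ (n + 1) (σ (n + 1))) 3 - σ n 3

/-- The shear in the `n`-th frame which remains after the correction. -/
def shear (d : ℕ → ℂ) (n : ℕ) (x : ℂ × ℂ) : ℂ × ℂ := x + (d n * F.lam n x ^ 2) • F.v n

variable {F Q}

theorem corr_map_add (hC : 0 < C) {σ : ℕ → Fin 6 → ℂ}
    (hσ : ∀ n, σ n = backStep N F.a F.b F.c F.κ F.τ (F.quadCoeff Q) n (σ (n + 1)))
    (n : ℕ) (x : ℂ × ℂ) :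
    F.corr σ (n + 1) (A n x) + Q n x x =
      A n (F.corr σ n x + (F.defect Q σ n * F.lam n x ^ 2) • F.v n) := by
  have ha : F.a n ≠ 0 := norm_pos_iff.1 (hC.trans_le (F.a_bound n).1)
  have hb : F.b n ≠ 0 := norm_pos_iff.1 (hC.trans_le (F.b_bound n).1)
  set P := quadPull (F.a n) (F.b n) (F.c n) (F.quadCoeff Q n)
    (incoming N F.κ F.τ (n + 1) (σ (n + 1))) with hP
  have hPσ : ∀ i, i ≠ 3 → σ n i = P i := fun i hi => by
    rw [hσ n, backStep_of_ne n _ hi]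
  have e1 : F.corr σ n x + (F.defect Q σ n * F.lam n x ^ 2) • F.v n =
      frameQuad (F.u n) (F.v n) (F.lam n) (F.mu n) P x := by
    rw [corr, frameQuad, frameQuad, defect, ← hP, add_assoc, ← add_smul]
    simp only [quadEval, hPσ 0 (by decide), hPσ 1 (by decide), hPσ 2 (by decide),
      hPσ 4 (by decide), hPσ 5 (by decide)]
    congr 2
    ring
  have e2 := quadEval_quadPull (F.c n) ha hb (F.quadCoeff Q n)
    (incoming N F.κ F.τ (n + 1) (σ (n + 1))) (F.lam n x) (F.mu n x)
  rw [← hP] at e2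
  rw [e1, corr, F.change, bilin_eq (F.frame n) (F.frame' n) (Q n) x,
    (F.frame' n).expand (A n (frameQuad _ _ _ _ P x)), frameQuad, frameQuad, F.lam_map, F.mu_map,
    F.lam_map, F.mu_map, (F.frame n).lam_comb, (F.frame n).mu_comb]
  have e3 := congrArg Prod.fst e2
  have e4 := congrArg Prod.snd e2
  simp only [Prod.fst_add, Prod.snd_add] at e3 e4
  rw [← e3, ← e4, quadCoeff]
  module

theorem norm_defect_le (hC : 0 < C) (hC1 : C ≤ 1) (hD : D ≤ 1) {K₀ K ω : ℝ}
    (hQ : ∀ n, ‖Q n‖ ≤ K₀) (hω : 1 ≤ ω) {σ : ℕ → Fin 6 → ℂ}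
    (hσ : ∀ n i, ‖σ n i‖ ≤ K * ω ^ n) (n : ℕ) :
    ‖F.defect Q σ n‖ ≤ (100 / C ^ 2 * (100 * K * ω + 4 * K₀) + K) * ω ^ n := by
  have hK₀ : 0 ≤ K₀ := (norm_nonneg (Q 0)).trans (hQ 0)
  have hωn : 1 ≤ ω ^ n := one_le_pow₀ hω
  have h1 := norm_quadPull_le hC hC1 hD (F.a_bound n).1 (F.a_bound n).2 (F.b_bound n).1
    (F.b_bound n).2 (F.c_bound n) (fun i => (F.coeffBounds Q hQ).Q_bound n i)
    (norm_incoming_le (N := N) (F.κ_bound (n + 1)).1 (F.κ_bound (n + 1)).2 (F.τ_bound (n + 1))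
      (hσ (n + 1))) 3
  refine (norm_sub_le _ _).trans ((add_le_add h1 (hσ n 3)).trans ?_)
  rw [add_mul _ K, mul_assoc (100 / C ^ 2)]
  gcongr
  rw [add_mul, pow_succ]
  have : 4 * K₀ * 1 ≤ 4 * K₀ * ω ^ n := by gcongr
  linarith

end AdaptedFrames

/-- A nonnegative sequence with `p (j + 1) ≤ t j * (p j + K * p j ^ 2)`, where `t` decays
doubly exponentially, cannot stay above `1`. -/
theorem exists_le_one_of_superexponential {K T : ℝ} (hK : 1 ≤ K) (hT : 0 < T) (hT1 : T < 1)
    {p t : ℕ → ℝ} (ht0 : ∀ i, 0 ≤ t i) (ht : ∀ i, t i ≤ T ^ 2 ^ i)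
    (hp : ∀ i, p (i + 1) ≤ t i * (p i + K * p i ^ 2)) : ∃ i, p i ≤ 1 := by
  by_contra! hcon
  have step : ∀ i, 2 * K * p (i + 1) ≤ T ^ 2 ^ i * (2 * K * p i) ^ 2 := fun i => by
    have h1 := hcon i
    have h2 : p i + K * p i ^ 2 ≤ 2 * K * p i ^ 2 := by nlinarith
    calc 2 * K * p (i + 1) ≤ 2 * K * (t i * (p i + K * p i ^ 2)) := by gcongr; exact hp i
      _ ≤ 2 * K * (T ^ 2 ^ i * (2 * K * p i ^ 2)) := by
          have := ht0 i
          gcongr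
          exact ht i
      _ = _ := by ring
  have hw : ∀ i, 1 ≤ 2 * K * p i := fun i => by nlinarith [hcon i]
  have key : ∀ i, (2 * K * p i) ^ 2 ≤ ((2 * K * p 0) ^ 2 * T ^ i) ^ 2 ^ i := by
    intro i
    induction i with
    | zero => simp
    | succ i ih =>
      have h0 : 0 ≤ 2 * K * p (i + 1) := by linarith [hw (i + 1)]
      calc (2 * K * p (i + 1)) ^ 2 ≤ (T ^ 2 ^ i * (2 * K * p i) ^ 2) ^ 2 :=
            pow_le_pow_left₀ h0 (step i) 2
        _ ≤ (T ^ 2 ^ i * ((2 * K * p 0) ^ 2 * T ^ i) ^ 2 ^ i) ^ 2 := by gcongr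
        _ = _ := by
          rw [← mul_pow, ← pow_mul, pow_succ 2 i, pow_succ T i]
          congr 1
          ring
  have hlim : Tendsto (fun i => (2 * K * p 0) ^ 2 * T ^ i) atTop (𝓝 0) := by
    simpa using (tendsto_pow_atTop_nhds_zero_of_lt_one hT.le hT1).const_mul ((2 * K * p 0) ^ 2)
  obtain ⟨i, hi⟩ := (hlim.eventually_lt_const one_pos).exists
  have h1 : ((2 * K * p 0) ^ 2 * T ^ i) ^ 2 ^ i < 1 :=
    pow_lt_one₀ (by positivity) hi (by positivity)
  nlinarith [key i, hw i]

/-- A sequence with `ρ (j + 1) ≤ ρ j + K * t j * ρ j ^ 2`, where `t` decays doubly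
exponentially, is eventually bounded. -/
theorem exists_bound_of_quadratic_growth {K T : ℝ} (hK : 1 ≤ K) (hT : 0 < T) (hT1 : T < 1)
    {ρ t : ℕ → ℝ} (hρ0 : ∀ i, 0 ≤ ρ i) (ht0 : ∀ i, 0 ≤ t i) (ht : ∀ i, t i ≤ T ^ (2 ^ i - 1))
    (ht2 : ∀ i, t (i + 1) ≤ t i ^ 2)
    (hρ : ∀ i, ρ (i + 1) ≤ ρ i + K * t i * ρ i ^ 2) : ∃ j₀ M, ∀ j, j₀ ≤ j → ρ j ≤ M := by
  have hp : ∀ i, ρ (i + 1) * t (i + 1) ≤ t i * (ρ i * t i + K * (ρ i * t i) ^ 2) := fun i => by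
    have := hρ0 i
    have := ht0 i
    calc ρ (i + 1) * t (i + 1) ≤ (ρ i + K * t i * ρ i ^ 2) * t i ^ 2 := by
          have := ht0 (i + 1)
          gcongr
          exacts [hρ i, ht2 i]
      _ = _ := by ring
  have hpow : ∀ i, i ≤ 2 ^ i - 1 := fun i => Nat.le_sub_one_of_lt i.lt_two_pow_self
  obtain ⟨j₁, hj₁⟩ : ∃ j₁, ∀ j, j₁ ≤ j → t j * (1 + K) ≤ 1 / 2 := by
    have hlim : Tendsto (fun i => T ^ i * (1 + K)) atTop (𝓝 0) := by
      simpa using (tendsto_pow_atTop_nhds_zero_of_lt_one hT.le hT1).mul_const (1 + K)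
    obtain ⟨j₁, h⟩ := eventually_atTop.1 (hlim.eventually_le_const (half_pos one_pos))
    refine ⟨j₁, fun j hj => le_trans ?_ (h j hj)⟩
    have := (ht j).trans (pow_le_pow_of_le_one hT.le hT1.le (hpow j))
    gcongr
  have hpow' : ∀ i, 2 ^ i ≤ 2 ^ (j₁ + 1 + i) - 1 := fun i => by
    have h1 : 2 ^ (i + 1) ≤ 2 ^ (j₁ + 1 + i) := Nat.pow_le_pow_right two_pos (by omega)
    have h2 : 1 ≤ 2 ^ i := Nat.one_le_two_pow
    rw [pow_succ] at h1
    omega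
  obtain ⟨i₀, hi₀⟩ := exists_le_one_of_superexponential hK hT hT1
    (p := fun i => ρ (j₁ + 1 + i) * t (j₁ + 1 + i)) (t := fun i => t (j₁ + 1 + i))
    (fun i => ht0 _) (fun i => (ht _).trans (pow_le_pow_of_le_one hT.le hT1.le (hpow' i)))
    (fun i => hp _)
  set j := j₁ + 1 + i₀ with hj
  have hps : ∀ i, ρ (j + i) * t (j + i) ≤ (1 / 2) ^ i := by
    intro i
    induction i with
    | zero => simpa using hi₀
    | succ i ih =>
      have h1 := hj₁ (j + i) (by omega)
      have h2 := hp (j + i)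
      have h0 : 0 ≤ ρ (j + i) * t (j + i) := mul_nonneg (hρ0 _) (ht0 _)
      have h3 : ρ (j + i) * t (j + i) ≤ 1 := ih.trans (pow_le_one₀ (by norm_num) (by norm_num))
      have h4 : (ρ (j + i) * t (j + i)) ^ 2 ≤ ρ (j + i) * t (j + i) := by nlinarith
      have := ht0 (j + i)
      calc ρ (j + (i + 1)) * t (j + (i + 1)) ≤ _ := h2
        _ ≤ t (j + i) * (ρ (j + i) * t (j + i) + K * (ρ (j + i) * t (j + i))) := by gcongr
        _ = (t (j + i) * (1 + K)) * (ρ (j + i) * t (j + i)) := by ring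
        _ ≤ 1 / 2 * (1 / 2) ^ i := by gcongr
        _ = _ := (pow_succ' _ _).symm
  have hb : ∀ i, ρ (j + i) ≤ ρ j * Real.exp (K * (2 - 2 * (1 / 2) ^ i)) := by
    intro i
    induction i with
    | zero => simp
    | succ i ih =>
      have h0 := hρ0 (j + i)
      calc ρ (j + (i + 1)) ≤ ρ (j + i) + K * t (j + i) * ρ (j + i) ^ 2 := hρ _
        _ = ρ (j + i) * (K * (ρ (j + i) * t (j + i)) + 1) := by ring
        _ ≤ ρ (j + i) * (K * (1 / 2) ^ i + 1) := by gcongr; exact hps i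
        _ ≤ ρ (j + i) * Real.exp (K * (1 / 2) ^ i) := by gcongr; exact Real.add_one_le_exp _
        _ ≤ ρ j * Real.exp (K * (2 - 2 * (1 / 2) ^ i)) * Real.exp (K * (1 / 2) ^ i) := by gcongr
        _ = _ := by
          rw [mul_assoc, ← Real.exp_add, pow_succ]
          congr 2
          ring
  refine ⟨j, ρ j * Real.exp (K * 2), fun n hn => ?_⟩
  obtain ⟨i, rfl⟩ := Nat.exists_eq_add_of_le hn
  refine (hb i).trans ?_
  have := hρ0 j
  gcongr
  have : (0 : ℝ) < (1 / 2) ^ i := by positivity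
  linarith

/-- Growth along trains: `r` increases by a quadratic term in `m`, and `m ≤ r` does not increase
inside a train. -/
theorem exists_bound_of_train_growth {N : ℕ} (hN : 0 < N) {K T : ℝ} (hK : 0 ≤ K) (hT : 0 < T)
    (hT1 : T < 1) {r m : ℕ → ℝ} (hm0 : ∀ k, 0 ≤ m k) (hmr : ∀ k, m k ≤ r k)
    (hr : ∀ k, r (k + 1) ≤ r k + K * T ^ k * m k ^ 2)
    (hm : ∀ k, ¬ IsTrainStart N (k + 1) → m (k + 1) ≤ m k) :
    ∃ M, ∀ᶠ k in atTop, r k ≤ M := by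
  have hr0 : ∀ k, 0 ≤ r k := fun k => (hm0 k).trans (hmr k)
  have hmt : ∀ j i, i < N * 2 ^ j → m (trainStart N j + i) ≤ r (trainStart N j) := by
    intro j i
    induction i with
    | zero => exact fun _ => hmr _
    | succ i ih =>
      intro hi
      refine (hm (trainStart N j + i) (not_isTrainStart hN (j := j) (by omega) ?_)).trans (ih (by omega))
      rw [trainStart_succ]
      omega
  have hK1 : 0 ≤ K / (1 - T) := div_nonneg hK (by linarith)
  set L := K / (1 - T) + 1 with hL
  have hrt : ∀ j i, i ≤ N * 2 ^ j → r (trainStart N j + i) ≤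
      r (trainStart N j) + L * T ^ trainStart N j * r (trainStart N j) ^ 2 := by
    intro j i hi
    have h1 : ∀ i, i ≤ N * 2 ^ j → r (trainStart N j + i) ≤ r (trainStart N j) +
        K * T ^ trainStart N j * r (trainStart N j) ^ 2 * ∑ l ∈ Finset.range i, T ^ l := by
      intro i
      induction i with
      | zero => simp
      | succ i ih =>
        intro hi
        have h2 := hmt j i (by omega)
        have h3 := hm0 (trainStart N j + i)
        calc r (trainStart N j + (i + 1)) ≤ _ := hr (trainStart N j + i)
          _ ≤ r (trainStart N j + i) +
              K * T ^ (trainStart N j + i) * r (trainStart N j) ^ 2 := by gcongr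
          _ ≤ _ := by
            rw [Finset.sum_range_succ, pow_add]
            linarith [ih (by omega)]
    have hsum : ∑ l ∈ Finset.range i, T ^ l ≤ (1 - T)⁻¹ := by
      rw [← tsum_geometric_of_lt_one hT.le hT1]
      exact (summable_geometric_of_lt_one hT.le hT1).sum_le_tsum _ fun l _ => by positivity
    calc _ ≤ _ := h1 i hi
      _ ≤ r (trainStart N j) +
          K * T ^ trainStart N j * r (trainStart N j) ^ 2 * (1 - T)⁻¹ := by gcongr
      _ = r (trainStart N j) +
          K / (1 - T) * T ^ trainStart N j * r (trainStart N j) ^ 2 := by ring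
      _ ≤ _ := by
        gcongr
        linarith
  obtain ⟨j₀, M, hM⟩ := exists_bound_of_quadratic_growth (K := L) (by linarith) hT hT1
    (ρ := fun j => r (trainStart N j)) (t := fun j => T ^ trainStart N j) (fun j => hr0 _)
    (fun j => by positivity)
    (fun j => pow_le_pow_of_le_one hT.le hT1.le (Nat.le_mul_of_pos_left _ hN))
    (fun j => by
      rw [← pow_mul]
      refine pow_le_pow_of_le_one hT.le hT1.le ?_
      have := trainStart_add N j
      rw [trainStart_succ]
      omega)
    (fun j => by
      have := hrt j _ le_rfl
      rwa [← trainStart_succ] at this)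
  have hM0 : 0 ≤ M := (hr0 _).trans (hM j₀ le_rfl)
  refine ⟨M + L * 1 * M ^ 2, eventually_atTop.2 ⟨trainStart N j₀, fun k hk => ?_⟩⟩
  obtain ⟨j, hj1, hj2⟩ := exists_mem_train hN k
  have hjj : j₀ ≤ j := by
    have := (trainStart_strictMono hN).lt_iff_lt.1 (hk.trans_lt hj2)
    omega
  obtain ⟨i, rfl⟩ := Nat.exists_eq_add_of_le hj1
  rw [trainStart_succ] at hj2
  refine (hrt j i (by omega)).trans ?_
  have h1 := hM j hjj
  have h2 := hr0 (trainStart N j)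
  have h3 : T ^ trainStart N j ≤ 1 := pow_le_one₀ hT.le hT1.le
  gcongr

namespace AdaptedFrames

variable {N : ℕ} {C D : ℝ} {A : ℕ → ℂ × ℂ →L[ℂ] ℂ × ℂ} (F : AdaptedFrames N C D A)

theorem lam_shear (d : ℕ → ℂ) (n : ℕ) (x : ℂ × ℂ) : F.lam n (F.shear d n x) = F.lam n x := by
  simp [shear, (F.frame n).lam_v]

/-- Orbits of the compositions of shears and linear maps decay like `D ^ k`. -/
theorem exists_norm_orbit_le (hN : 0 < N) (hD : 0 < D) {ω K : ℝ} (hω : 0 < ω) (hωD : ω * D < 1)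
    (hK : 0 ≤ K) (hA : ∀ n x, ‖A n x‖ ≤ D * ‖x‖) {d : ℕ → ℂ} (hd : ∀ n, ‖d n‖ ≤ K * ω ^ n)
    {x : ℕ → ℂ × ℂ} (hx : ∀ n, x (n + 1) = A n (F.shear d n (x n))) :
    ∃ M, ∀ᶠ k in atTop, ‖x k‖ ≤ M * D ^ k := by
  have hr : ∀ k, ‖x (k + 1)‖ / D ^ (k + 1) ≤
      ‖x k‖ / D ^ k + K * (ω * D) ^ k * (‖F.lam k (x k)‖ / D ^ k) ^ 2 := fun k => by
    have h1 : ‖F.shear d k (x k)‖ ≤ ‖x k‖ + K * ω ^ k * ‖F.lam k (x k)‖ ^ 2 := by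
      refine (norm_add_le _ _).trans ?_
      rw [norm_smul, (F.frame k).norm_v, mul_one, norm_mul, norm_pow]
      gcongr
      exact hd k
    rw [hx, div_le_iff₀ (by positivity)]
    calc _ ≤ D * ‖F.shear d k (x k)‖ := hA _ _
      _ ≤ D * (‖x k‖ + K * ω ^ k * ‖F.lam k (x k)‖ ^ 2) := by gcongr
      _ = _ := by
        rw [mul_pow]
        field_simp
        ring
  have hm : ∀ k, ¬ IsTrainStart N (k + 1) →
      ‖F.lam (k + 1) (x (k + 1))‖ / D ^ (k + 1) ≤ ‖F.lam k (x k)‖ / D ^ k := fun k hk => by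
    rw [hx, F.lam_eq k hk, F.lam_map, F.lam_shear, norm_mul, pow_succ', mul_div_mul_comm]
    refine mul_le_of_le_one_left (by positivity) ?_
    rw [div_le_one hD]
    exact (F.a_bound k).2
  obtain ⟨M, hM⟩ := exists_bound_of_train_growth hN hK (mul_pos hω hD) hωD
    (r := fun k => ‖x k‖ / D ^ k) (m := fun k => ‖F.lam k (x k)‖ / D ^ k)
    (fun k => by positivity) (fun k => by gcongr; exact (F.frame k).norm_lam _) hr hm
  refine ⟨M, hM.mono fun k hk => ?_⟩
  rwa [div_le_iff₀ (by positivity)] at hk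

end AdaptedFrames

theorem tendsto_mul_pow_mul_pow {a b : ℝ} (ha : 0 ≤ a) (hb : 0 ≤ b) (hab : a * b < 1) (K : ℝ) :
    Tendsto (fun k : ℕ => K * (a ^ k * b ^ k)) atTop (𝓝 0) := by
  simpa [mul_pow] using
    (tendsto_pow_atTop_nhds_zero_of_lt_one (mul_nonneg ha hb) hab).const_mul K

namespace AdaptedFrames

variable {N : ℕ} {C D : ℝ} {A : ℕ → ℂ × ℂ →L[ℂ] ℂ × ℂ} {F : AdaptedFrames N C D A}
  {Q : ℕ → ℂ × ℂ →L[ℂ] ℂ × ℂ →L[ℂ] ℂ × ℂ} {K P ω : ℝ} {σ : ℕ → Fin 6 → ℂ} {d : ℕ → ℂ}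
  {f : ℕ → ℂ × ℂ → ℂ × ℂ}

theorem shear_neg_shear (n : ℕ) (x : ℂ × ℂ) : F.shear (-d) n (F.shear d n x) = x := by
  rw [shear, lam_shear, shear]
  simp

theorem shear_shear_neg (n : ℕ) (x : ℂ × ℂ) : F.shear d n (F.shear (-d) n x) = x := by
  simpa using shear_neg_shear (F := F) (d := -d) n x

theorem analyticOnNhd_shear (d : ℕ → ℂ) (n : ℕ) : AnalyticOnNhd ℂ (F.shear d n) univ := by
  intro x _
  unfold shear
  have h1 : AnalyticAt ℂ (fun x => F.lam n x) x := (F.lam n).analyticAt x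
  fun_prop

theorem norm_shear_sub_shear_le {n : ℕ} {L : ℝ} (hd : ‖d n‖ ≤ L) (x y : ℂ × ℂ) :
    ‖F.shear d n x - F.shear d n y‖ ≤ (1 + L * (‖x‖ + ‖y‖)) * ‖x - y‖ := by
  have hL := (norm_nonneg _).trans hd
  have e : F.shear d n x - F.shear d n y =
      (x - y) + (d n * (F.lam n (x + y) * F.lam n (x - y))) • F.v n := by
    rw [shear, shear, map_add, map_sub]
    module
  rw [e]
  refine (norm_add_le _ _).trans ?_
  rw [norm_smul, (F.frame n).norm_v, mul_one, norm_mul, norm_mul, add_mul, one_mul, mul_assoc L]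
  gcongr
  · exact ((F.frame n).norm_lam _).trans (norm_add_le _ _)
  · exact (F.frame n).norm_lam _

theorem norm_corr_le (hσ : ∀ n i, ‖σ n i‖ ≤ K * ω ^ n) (n : ℕ) (x : ℂ × ℂ) :
    ‖F.corr σ n x‖ ≤ 14 * K * ω ^ n * ‖x‖ ^ 2 := by
  rw [mul_assoc 14]
  exact norm_frameQuad_le (F.frame n) (hσ n) x

theorem norm_conjugacy_error_le (hC : 0 < C) (hD : D ≤ 1)
    (hA : ∀ n x, ‖A n x‖ ≤ D * ‖x‖) (hf : ∀ n x, ‖x‖ < 1 → ‖f n x‖ ≤ D * ‖x‖)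
    (hQ : ∀ n, ‖Q n‖ ≤ P)
    (hT : ∀ n x, ‖x‖ ≤ 1 / 2 → ‖f n x - A n x - Q n x x‖ ≤ P * ‖x‖ ^ 3)
    (hω : 1 ≤ ω) (hσK : ∀ n i, ‖σ n i‖ ≤ K * ω ^ n)
    (hσ : ∀ n, σ n = backStep N F.a F.b F.c F.κ F.τ (F.quadCoeff Q) n (σ (n + 1)))
    (hd : ∀ n, ‖F.defect Q σ n‖ ≤ K * ω ^ n) {n : ℕ} {x : ℂ × ℂ} (hx : ‖x‖ ≤ 1 / 2)
    (hx' : 14 * K * ω ^ n * ‖x‖ ≤ 1) :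
    ‖(f n x + F.corr σ (n + 1) (f n x)) - A n (F.shear (F.defect Q σ) n (x + F.corr σ n x))‖ ≤
      (P + 168 * P * K * ω + 42 * K ^ 2) * (ω ^ n) ^ 2 * ‖x‖ ^ 3 := by
  have hP : 0 ≤ P := (norm_nonneg (Q 0)).trans (hQ 0)
  have hωn : 1 ≤ ω ^ n := one_le_pow₀ hω
  have hK : 0 ≤ K * ω ^ n := (norm_nonneg _).trans (hd n)
  have hK0 : 0 ≤ K := nonneg_of_mul_nonneg_left hK (by linarith)
  have hnx := norm_nonneg x
  set y := f n x - A n x with hy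
  have hAx : ‖A n x‖ ≤ ‖x‖ := (hA n x).trans (mul_le_of_le_one_left hnx hD)
  have hfx : ‖f n x‖ ≤ ‖x‖ :=
    (hf n x (by linarith)).trans (mul_le_of_le_one_left hnx hD)
  have hy2 : ‖y‖ ≤ 2 * ‖x‖ := (norm_sub_le _ _).trans (by linarith)
  have hyQ : ‖y‖ ≤ 2 * P * ‖x‖ ^ 2 := by
    have h1 := hT n x hx
    have h2 : ‖Q n x x‖ ≤ P * ‖x‖ * ‖x‖ := ((Q n).le_opNorm₂ x x).trans (by gcongr; exact hQ n)
    have h3 : ‖y‖ ≤ ‖y - Q n x x‖ + ‖Q n x x‖ := by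
      simpa using norm_add_le (y - Q n x x) (Q n x x)
    have h4 : P * ‖x‖ ^ 3 ≤ P * ‖x‖ ^ 2 :=
      mul_le_mul_of_nonneg_left (pow_le_pow_of_le_one hnx (by linarith) (by norm_num)) hP
    linarith
  have hB := norm_corr_le (F := F) hσK n x
  have e : (f n x + F.corr σ (n + 1) (f n x)) -
      A n (F.shear (F.defect Q σ) n (x + F.corr σ n x)) =
      (y - Q n x x) + (F.corr σ (n + 1) (A n x + y) - F.corr σ (n + 1) (A n x)) +
      A n (-(F.defect Q σ n * (F.lam n (x + x + F.corr σ n x) *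
        F.lam n (F.corr σ n x))) • F.v n) := by
    have h1 := corr_map_add hC hσ n x
    have h2 : f n x = A n x + y := by rw [hy]; abel
    have h3 : F.corr σ (n + 1) (A n x) =
      A n (F.corr σ n x + (F.defect Q σ n * F.lam n x ^ 2) • F.v n) - Q n x x := by
      rw [← h1, add_sub_cancel_right]
    rw [← h2, h3, h2, shear]
    simp only [map_add, map_smul, map_neg, neg_smul]
    module
  rw [e]
  have t1 := hT n x hx
  have t2 : ‖F.corr σ (n + 1) (A n x + y) - F.corr σ (n + 1) (A n x)‖ ≤
      168 * P * K * ω * (ω ^ n * ‖x‖ ^ 3) := by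
    refine (norm_frameQuad_add_sub_le (F.frame (n + 1)) (hσK (n + 1)) (A n x) y).trans ?_
    calc _ ≤ 28 * (K * ω ^ (n + 1)) * (‖x‖ + 2 * ‖x‖) * (2 * P * ‖x‖ ^ 2) := by gcongr
      _ = _ := by ring
  have t3 : ‖A n (-(F.defect Q σ n * (F.lam n (x + x + F.corr σ n x) *
        F.lam n (F.corr σ n x))) • F.v n)‖ ≤ 42 * K ^ 2 * ((ω ^ n) ^ 2 * ‖x‖ ^ 3) := by
    have h1 : ‖x + x + F.corr σ n x‖ ≤ 3 * ‖x‖ := by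
      refine (norm_add_le _ _).trans ?_
      have := norm_add_le x x
      have h2 : 14 * K * ω ^ n * ‖x‖ ^ 2 ≤ ‖x‖ := by nlinarith
      linarith
    refine (hA _ _).trans ((mul_le_of_le_one_left (norm_nonneg _) hD).trans ?_)
    rw [norm_smul, (F.frame n).norm_v, mul_one, norm_neg, norm_mul, norm_mul]
    calc _ ≤ (K * ω ^ n) * ((3 * ‖x‖) * (14 * K * ω ^ n * ‖x‖ ^ 2)) := by
          gcongr
          · exact hd n
          · exact ((F.frame n).norm_lam _).trans h1
          · exact ((F.frame n).norm_lam _).trans hB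
      _ = _ := by ring
  have hx3 : 0 ≤ ‖x‖ ^ 3 := by positivity
  have s1 : P * ‖x‖ ^ 3 ≤ P * ((ω ^ n) ^ 2 * ‖x‖ ^ 3) :=
    mul_le_mul_of_nonneg_left (le_mul_of_one_le_left hx3 (one_le_pow₀ hωn)) hP
  have s2 : 168 * P * K * ω * (ω ^ n * ‖x‖ ^ 3) ≤
      168 * P * K * ω * ((ω ^ n) ^ 2 * ‖x‖ ^ 3) := by
    gcongr
    exact le_self_pow₀ hωn two_ne_zero
  calc _ ≤ P * ‖x‖ ^ 3 + 168 * P * K * ω * (ω ^ n * ‖x‖ ^ 3) +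
        42 * K ^ 2 * ((ω ^ n) ^ 2 * ‖x‖ ^ 3) := 
          norm_add₃_le.trans (add_le_add (add_le_add t1 t2) t3)
    _ ≤ _ := by linarith

theorem asymptoticConjugacy (hC : 0 < C) (hCD : C ≤ D) (hD : D < 1)
    (hA : ∀ n x, C * ‖x‖ ≤ ‖A n x‖ ∧ ‖A n x‖ ≤ D * ‖x‖)
    (hf : ∀ n x, ‖x‖ < 1 → ‖f n x‖ ≤ D * ‖x‖) (hQ : ∀ n, ‖Q n‖ ≤ P)
    (hT : ∀ n x, ‖x‖ ≤ 1 / 2 → ‖f n x - A n x - Q n x x‖ ≤ P * ‖x‖ ^ 3)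
    (hω : 1 ≤ ω) (hωD : ω * D < 1) (hωC : ω ^ 2 * D ^ 3 < C)
    (hσK : ∀ n i, ‖σ n i‖ ≤ K * ω ^ n)
    (hσ : ∀ n, σ n = backStep N F.a F.b F.c F.κ F.τ (F.quadCoeff Q) n (σ (n + 1)))
    (hd : ∀ n, ‖F.defect Q σ n‖ ≤ K * ω ^ n) {B : ℕ → ℂ × ℂ →L[ℂ] ℂ × ℂ}
    (hBA : ∀ n x, B n (A n x) = x) (hAB : ∀ n y, A n (B n y) = y) :
    AsymptoticConjugacy f (fun n x => x + F.corr σ n x)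
      (fun n x => A n (F.shear (F.defect Q σ) n x))
      (fun n y => F.shear (-F.defect Q σ) n (B n y)) D ((ω ^ 2 * D ^ 3 + C) / 2)
      (ω ^ 2 * D ^ 3) := by
  have hD0 : 0 < D := hC.trans_le hCD
  have hω0 : 0 < ω := one_pos.trans_le hω
  have hP : 0 ≤ P := (norm_nonneg (Q 0)).trans (hQ 0)
  have hK0 : 0 ≤ K := by simpa using (norm_nonneg _).trans (hd 0)
  refine ⟨by positivity, by linarith, by linarith, hD, hf, fun n x => ?_, fun n x => ?_,
    fun M hM ε hε => ?_, fun M hM => ?_, fun M hM => ?_⟩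
  · simp only [hBA, shear_neg_shear]
  · simp only [shear_shear_neg, hAB]
  · have hlim := tendsto_mul_pow_mul_pow hω0.le hD0.le hωD (14 * K * M ^ 2)
    filter_upwards [hlim.eventually_le_const hε] with k hk x hx
    rw [add_sub_cancel_left]
    calc _ ≤ 14 * K * ω ^ k * ‖x‖ ^ 2 := norm_corr_le hσK k x
      _ ≤ 14 * K * ω ^ k * (M * D ^ k) ^ 2 := by gcongr
      _ = 14 * K * M ^ 2 * (ω ^ k * D ^ k) * D ^ k := by ring
      _ ≤ _ := by gcongr
  · refine ⟨(P + 168 * P * K * ω + 42 * K ^ 2) * M ^ 3, ?_⟩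
    have h1 := tendsto_mul_pow_mul_pow hω0.le hD0.le hωD (14 * K * M)
    have h2 : Tendsto (fun k : ℕ => M * D ^ k) atTop (𝓝 0) := by
      simpa using (tendsto_pow_atTop_nhds_zero_of_lt_one hD0.le hD).const_mul M
    filter_upwards [h1.eventually_le_const one_pos, h2.eventually_le_const (half_pos one_pos)]
      with k hk1 hk2 x hx
    have hx1 : 14 * K * ω ^ k * ‖x‖ ≤ 1 :=
      calc _ ≤ 14 * K * ω ^ k * (M * D ^ k) := by gcongr
        _ = 14 * K * M * (ω ^ k * D ^ k) := by ring
        _ ≤ 1 := hk1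
    calc _ ≤ (P + 168 * P * K * ω + 42 * K ^ 2) * (ω ^ k) ^ 2 * ‖x‖ ^ 3 :=
          norm_conjugacy_error_le hC hD.le (fun n x => (hA n x).2) hf hQ hT hω hσK hσ hd
            (hx.trans hk2) hx1
      _ ≤ (P + 168 * P * K * ω + 42 * K ^ 2) * (ω ^ k) ^ 2 * (M * D ^ k) ^ 3 := by gcongr
      _ = _ := by
        rw [mul_pow, mul_pow, ← pow_mul, ← pow_mul, ← pow_mul, ← pow_mul, mul_comm k 2,
          mul_comm k 3]
        ring
  · have h1 := tendsto_mul_pow_mul_pow hω0.le hD0.le hωD (K * (2 * (C⁻¹ * M)))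
    have hc : 0 < (ω ^ 2 * D ^ 3 + C) / 2 := by positivity
    have hlt : (1 + 0) * C⁻¹ < ((ω ^ 2 * D ^ 3 + C) / 2)⁻¹ := by
      rw [add_zero, one_mul]
      exact inv_strictAnti₀ hc (by linarith)
    filter_upwards [((h1.const_add 1).mul_const C⁻¹).eventually_le_const hlt] with k hk y y' hy hy'
    have hB : ∀ z, ‖B k z‖ ≤ C⁻¹ * ‖z‖ := fun z => by
      have := (hA k (B k z)).1
      rwa [hAB, mul_comm, ← le_div_iff₀ hC, div_eq_inv_mul] at this
    have hd' : ‖(-F.defect Q σ) k‖ ≤ K * ω ^ k := by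
      rw [Pi.neg_apply, norm_neg]
      exact hd k
    calc _ ≤ (1 + K * ω ^ k * (‖B k y‖ + ‖B k y'‖)) * ‖B k y - B k y'‖ :=
          norm_shear_sub_shear_le hd' _ _
      _ ≤ (1 + K * ω ^ k * (C⁻¹ * (M * D ^ k) + C⁻¹ * (M * D ^ k))) * (C⁻¹ * ‖y - y'‖) := by
          rw [← map_sub]
          gcongr
          · exact (hB y).trans (by gcongr)
          · exact (hB y').trans (by gcongr)
          · exact hB _
      _ = (1 + K * (2 * (C⁻¹ * M)) * (ω ^ k * D ^ k)) * C⁻¹ * ‖y - y'‖ := by ring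
      _ ≤ _ := by gcongr

end AdaptedFrames

theorem fderiv_bounds {f : ℂ × ℂ → ℂ × ℂ} {C D : ℝ} (hf : DifferentiableAt ℂ f 0) (h0 : f 0 = 0)
    (hb : ∀ z, ‖z‖ < 1 → C * ‖z‖ ≤ ‖f z‖ ∧ ‖f z‖ ≤ D * ‖z‖) (x : ℂ × ℂ) :
    C * ‖x‖ ≤ ‖fderiv ℂ f 0 x‖ ∧ ‖fderiv ℂ f 0 x‖ ≤ D * ‖x‖ := by
  have hlim := (hf.hasFDerivAt.hasLineDerivAt x).tendsto_slope_zero.norm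
  have hsmall : ∀ᶠ t : ℂ in 𝓝[≠] 0, ‖t • x‖ < 1 := by
    have : Tendsto (fun t : ℂ => ‖t • x‖) (𝓝 0) (𝓝 0) := by
      have : Continuous fun t : ℂ => ‖t • x‖ := by fun_prop
      simpa using this.tendsto 0
    exact (this.mono_left nhdsWithin_le_nhds).eventually_lt_const one_pos
  have key : ∀ᶠ t : ℂ in 𝓝[≠] 0, C * ‖x‖ ≤ ‖t⁻¹ • (f (0 + t • x) - f 0)‖ ∧
      ‖t⁻¹ • (f (0 + t • x) - f 0)‖ ≤ D * ‖x‖ := by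
    filter_upwards [hsmall, self_mem_nhdsWithin] with t ht ht0
    have hpos : 0 < ‖t‖ := norm_pos_iff.2 ht0
    have := hb _ ht
    rw [norm_smul] at this
    rw [zero_add, h0, sub_zero, norm_smul, norm_inv, ← div_eq_inv_mul, le_div_iff₀ hpos,
      div_le_iff₀ hpos]
    constructor <;> linarith
  exact ⟨ge_of_tendsto hlim (key.mono fun t h => h.1), le_of_tendsto hlim (key.mono fun t h => h.2)⟩

theorem exists_growth_rate {C D : ℝ} (hC : 0 < C) (h1 : D ^ 3 < C)
    (h2 : D ^ 7 < C ^ 3) : ∃ ω, 1 < ω ∧ D ^ 2 / C < ω ∧ ω ^ 2 * D ^ 3 < C := by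
  have h : (max 1 (D ^ 2 / C)) ^ 2 * D ^ 3 < C := by
    rcases max_choice 1 (D ^ 2 / C) with h | h <;> rw [h]
    · linarith
    · rw [div_pow, div_mul_eq_mul_div, div_lt_iff₀ (by positivity)]
      linarith
  have hcont : Continuous fun ω : ℝ => ω ^ 2 * D ^ 3 := by fun_prop
  have hev := ((hcont.tendsto (max 1 (D ^ 2 / C))).mono_left
    (nhdsWithin_le_nhds (s := Ioi (max 1 (D ^ 2 / C))))).eventually_lt_const h
  obtain ⟨ω, hω, hω'⟩ := (hev.and self_mem_nhdsWithin).exists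
  exact ⟨ω, (le_max_left _ _).trans_lt hω', (le_max_right _ _).trans_lt hω', hω⟩

theorem pow_lt_of_rpow_lt {C D : ℝ} (hD : 0 < D) (hD1 : D < 1)
    (h : D ^ ((11 : ℝ) / 5) < C) : D ^ 3 < C ∧ D ^ 7 < C ^ 3 := by
  constructor
  · refine lt_of_le_of_lt ?_ h
    rw [← Real.rpow_natCast]
    exact Real.rpow_le_rpow_of_exponent_ge hD hD1.le (by norm_num)
  · refine lt_of_le_of_lt ?_ (pow_lt_pow_left₀ h (Real.rpow_nonneg hD.le _) three_ne_zero)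
    rw [← Real.rpow_natCast, ← Real.rpow_natCast, ← Real.rpow_mul hD.le]
    exact Real.rpow_le_rpow_of_exponent_ge hD hD1.le (by norm_num)

/-- Theorem: if a uniformly attracting sequence of automorphisms of ℂ² satisfies
`D^(11/5) < C`, then its basin of attraction is biholomorphic to ℂ². -/
theorem basin_biholomorphic_of_eleven_fifths
    (f : ℕ → (ℂ × ℂ) → (ℂ × ℂ)) (C D : ℝ)
    (hC : 0 < C) (hCD : C < D) (hD : D < 1)
    (haut : ∀ n, IsAutomorphism (f n))
    (hattr : UniformlyAttracting f C D)
    (hDC : D ^ ((11 : ℝ) / 5) < C) :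
    BiholomorphicTo (basin f) Set.univ := by
  have hD0 : 0 < D := hC.trans hCD
  obtain ⟨h3, h7⟩ := pow_lt_of_rpow_lt hD0 hD hDC
  obtain ⟨ω, hω1, hω2, hω3⟩ := exists_growth_rate hC h3 h7
  have hω0 : 0 < ω := one_pos.trans hω1
  have hωD : ω * D < 1 := by
    have h : D * (ω * D) ^ 2 < D * 1 := by linarith
    have := lt_of_mul_lt_mul_left h hD0.le
    exact lt_of_pow_lt_pow_left₀ 2 zero_le_one (by simpa using this)
  obtain ⟨δ, hδ1, hδ2⟩ := exists_between (lt_min hD ((lt_div_iff₀' hω0).2 hωD))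
  rw [lt_min_iff, lt_div_iff₀' hω0] at hδ2
  obtain ⟨h0, hb⟩ := hattr
  have hfa : ∀ n, AnalyticOnNhd ℂ (f n) univ := fun n => analyticOn_univ.1 (haut n).1
  choose fi hfi hfl hfr using fun n => (haut n).2
  have hA := fun n => fderiv_bounds ((hfa n) 0 (mem_univ _)).differentiableAt (h0 n) (hb n)
  have hf : ∀ n x, ‖x‖ < 1 → ‖f n x‖ ≤ D * ‖x‖ := fun n x hx => (hb n x hx).2
  choose Q hQ hT using fun n => exists_norm_sub_taylor_le
    ((hfa n).mono (subset_univ (ball 0 1))) (h0 n) fun x hx => by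
      have hx1 := mem_ball_zero_iff.1 hx
      exact (hf n x hx1).trans (mul_le_one₀ hD.le (norm_nonneg x) hx1.le)
  choose B hBA hAB using fun n => exists_inverse_of_bounded_below hC fun x => (hA n x).1
  obtain ⟨N, hN, K, hK, hσ⟩ := exists_coeff hC hCD.le hδ1 hδ2.1.le hω1 hω2 hδ2.2
    (show (0 : ℝ) ≤ 4 * 4096 by norm_num)
  obtain ⟨F⟩ := nonempty_adaptedFrames N hC hD.le hA
  obtain ⟨σ, hσK, hσ⟩ := hσ _ _ _ _ _ _ (F.coeffBounds Q hQ)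
  have hd := AdaptedFrames.norm_defect_le (F := F) hC (hCD.trans hD).le hD.le hQ hω1.le hσK
  set L := 100 / C ^ 2 * (100 * K * ω + 4 * 4096) + K with hL
  have hKL : K ≤ L := le_add_of_nonneg_left (by positivity)
  have hσL : ∀ n i, ‖σ n i‖ ≤ L * ω ^ n := fun n i =>
    (hσK n i).trans (mul_le_mul_of_nonneg_right hKL (by positivity))
  have H := AdaptedFrames.asymptoticConjugacy hC hCD.le hD hA hf hQ hT hω1.le hωD hω3 hσL hσ hd
    hBA hAB
  have hlin : ∀ (T : ℂ × ℂ →L[ℂ] ℂ × ℂ), AnalyticOnNhd ℂ T univ := fun T x _ => T.analyticAt x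
  refine H.biholomorphicTo_univ hfa (fun n => analyticOn_univ.1 (hfi n)) hfl hfr
    (fun n => analyticOnNhd_id.add (analyticOnNhd_frameQuad _))
    (fun n => (hlin _).comp (AdaptedFrames.analyticOnNhd_shear _ n) (mapsTo_univ _ _))
    (fun n => (AdaptedFrames.analyticOnNhd_shear _ n).comp (hlin _) (mapsTo_univ _ _))
    fun y => F.exists_norm_orbit_le hN hD0 hω0 hωD (hK.trans hKL) (fun n x => (hA n x).2) hd
      fun n => ?_
  rw [orbitMap_succ, Nat.zero_add]
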